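/- Assume q > 2 is fixed. As g → ∞, each of the following ratios tends to 1: (1/#I_{g+1})·Σ_{u ∈ I_{g+1}} L(1/2,χ_u) divided by (g+1)·P(1); (1/#F_{g+1})·Σ_{u ∈ F_{g+1}} L(1/2,χ_u) divided by (g+1)·P(1); and (1/#F'_{g+1})·Σ_{u ∈ F'_{g+1}} L(1/2,χ_u) divided by (g+1)·P(1). -/

import Mathlib

open Polynomial UniqueFactorizationMonoid

noncomputable section

namespace EvenChar

variable {Fq : Type} [Field Fq] [Fintype Fq]

/-- Solvability of the congruence `X² + X ≡ u (mod P)` in `Fq[T]`. -/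
def hasseSolvable (u : RatFunc Fq) (P : Polynomial Fq) : Prop :=
  ∃ x : Polynomial Fq, P ∣ ((x ^ 2 + x) * u.denom - u.num)

open scoped Classical in
/-- The quadratic symbol `{u/f}` for a monic polynomial `f`. -/
def quadSym (u : RatFunc Fq) (f : Polynomial Fq) : ℤ :=
  if IsCoprime f u.denom then
    ((normalizedFactors f).map fun P => if hasseSolvable u P then (1 : ℤ) else -1).prod
  else 0

variable (Fq) in
/-- The family `F_n` of real quadratic `u`'s. -/
def Ffam (n : ℕ) : Set (RatFunc Fq) :=
  { u | ∃ (S : Finset (Polynomial Fq)) (e : Polynomial Fq → ℕ)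
        (a : Polynomial Fq → ℕ → Polynomial Fq),
      (∀ P ∈ S, P.Monic ∧ Irreducible P) ∧
      (∀ P ∈ S, 1 ≤ e P) ∧
      (∀ P ∈ S, ∀ i, 1 ≤ i → i ≤ e P → (a P i).degree < P.degree) ∧
      (∀ P ∈ S, a P (e P) ≠ 0) ∧
      (∑ P ∈ S, e P * P.natDegree) = n ∧
      u = ∑ P ∈ S, ∑ i ∈ Finset.Icc 1 (e P),
            algebraMap (Polynomial Fq) (RatFunc Fq) (a P i) /
              algebraMap (Polynomial Fq) (RatFunc Fq) P ^ (2 * i - 1) }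

/-- The family `G_s` of odd polynomial parts. -/
def Gfam (ξ : Fq) (s : ℕ) : Set (Polynomial Fq) :=
  { G | ∃ (α : Fq) (c : ℕ → Fq), (α = 0 ∨ α = ξ) ∧ c s ≠ 0 ∧
      G = C α + ∑ i ∈ Finset.Icc 1 s, C (c i) * X ^ (2 * i - 1) }

/-- The family `I_{(r,s)}`. -/
def Irs (ξ : Fq) (r s : ℕ) : Set (RatFunc Fq) :=
  { u | ∃ v ∈ Ffam Fq r, ∃ G ∈ Gfam ξ s,
      u = v + algebraMap (Polynomial Fq) (RatFunc Fq) G }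

/-- The family `I_n` of ramified imaginary `u`'s. -/
def Ifam (ξ : Fq) (n : ℕ) : Set (RatFunc Fq) :=
  ⋃ (r : ℕ) (s : ℕ) (_ : 1 ≤ s) (_ : r + s = n), Irs ξ r s

/-- The family `F'_n` of inert imaginary `u`'s. -/
def F'fam (ξ : Fq) (n : ℕ) : Set (RatFunc Fq) :=
  (fun u => u + RatFunc.C ξ) '' Ffam Fq n

/-- `A_u(n) = ∑_{f monic, deg f = n} χ_u(f)`. -/
def Acoeff (u : RatFunc Fq) (n : ℕ) : ℂ :=
  ∑' f : {f : Polynomial Fq // f.Monic ∧ f.natDegree = n}, (quadSym u f.1 : ℂ)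

/-- `L(s, χ_u)` as the polynomial `∑_{n=0}^{N} A_u(n) q^{-sn}` in `q^{-s}`. -/
def Lfun (N : ℕ) (u : RatFunc Fq) (s : ℂ) : ℂ :=
  ∑ n ∈ Finset.range (N + 1), Acoeff u n * (Fintype.card Fq : ℂ) ^ (-(s * (n : ℂ)))

/-- `ζ_A(s) = (1 - q^{1-s})⁻¹`. -/
def zetaC (q : ℕ) (s : ℂ) : ℂ := (1 - (q : ℂ) ^ ((1 : ℂ) - s))⁻¹

variable (Fq) in
/-- The Euler product `P(s) = ∏_P (1 - 1/(|P|^s (|P|+1)))`. -/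
def eulerP (s : ℂ) : ℂ :=
  ∏' P : {P : Polynomial Fq // P.Monic ∧ Irreducible P},
    (1 - (((Fintype.card Fq : ℂ) ^ (P.1.natDegree : ℂ)) ^ s *
          ((Fintype.card Fq : ℂ) ^ (P.1.natDegree : ℂ) + 1))⁻¹)

variable (Fq) in
/-- `(1/log q)·(P'/P)(1) = ∑_P deg P / (|P|(|P|+1) - 1)`. -/
def eulerPlogDeriv : ℂ :=
  ∑' P : {P : Polynomial Fq // P.Monic ∧ Irreducible P},
    (P.1.natDegree : ℂ) /
      ((Fintype.card Fq : ℂ) ^ (P.1.natDegree : ℂ) *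
        ((Fintype.card Fq : ℂ) ^ (P.1.natDegree : ℂ) + 1) - 1)

end EvenChar

namespace EvenChar
open scoped Classical
set_option linter.unusedSectionVars false

section Residues
variable {Fq : Type} [Field Fq]

/-- Residue of `N / f`. -/
def res (f N : Polynomial Fq) : Fq := (N %ₘ f).coeff (f.natDegree - 1)

lemma res_add (f N M : Polynomial Fq) : res f (N + M) = res f N + res f M := by
  simp [res, add_modByMonic]

lemma res_C_mul (f N : Polynomial Fq) (c : Fq) : res f (C c * N) = c * res f N := by
  simp [res, ← smul_eq_C_mul, smul_modByMonic]

lemma res_congr {f : Polynomial Fq} (hf : f.Monic) {N M : Polynomial Fq} (h : f ∣ N - M) :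
    res f N = res f M := by
  have := (modByMonic_eq_zero_iff_dvd hf).2 h
  rw [sub_modByMonic] at this
  rw [res, res, sub_eq_zero.1 this]

lemma res_of_lt {f : Polynomial Fq} (hf : f.Monic) {N : Polynomial Fq} (h : N.degree < f.degree) :
    res f N = N.coeff (f.natDegree - 1) := by
  rw [res, (modByMonic_eq_self_iff hf).2 h]

lemma mod_mul {f g : Polynomial Fq} (hf : f.Monic) (hg : g.Monic) (N : Polynomial Fq) :
    (N * g) %ₘ (f * g) = (N %ₘ f) * g := by
  refine (div_modByMonic_unique (N /ₘ f) _ (hf.mul hg) ⟨?_, ?_⟩).2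
  · conv_rhs => rw [← modByMonic_add_div N f]
    ring
  · rw [hg.degree_mul, hg.degree_mul]
    have := degree_modByMonic_lt N hf
    have h2 : g.degree ≠ ⊥ := by simpa using hg.ne_zero
    exact WithBot.add_lt_add_right h2 this

lemma res_mul_right {f g : Polynomial Fq} (hf : f.Monic) (hg : g.Monic) (N : Polynomial Fq) :
    res (f * g) (N * g) = res f N := by
  rw [res, mod_mul hf hg, res, hf.natDegree_mul hg]
  by_cases h0 : f.natDegree = 0
  · have : f = 1 := hf.natDegree_eq_zero.1 h0
    subst this
    simp
  · have h1 : f.natDegree + g.natDegree - 1 = (f.natDegree - 1) + g.natDegree := by omega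
    rw [h1, coeff_mul_add_eq_of_natDegree_le]
    · simp [hg]
    · have := natDegree_modByMonic_lt N hf (by rintro rfl; simp at h0)
      omega
    · exact le_rfl

/-- The logarithmic-derivative residue `Res (h f'/f)`. -/
def lam (f h : Polynomial Fq) : Fq := res f (h * derivative f)

lemma lam_add (f h k : Polynomial Fq) : lam f (h + k) = lam f h + lam f k := by
  simp [lam, add_mul, res_add]

lemma lam_congr {f : Polynomial Fq} (hf : f.Monic) {h k : Polynomial Fq} (hd : f ∣ h - k) :
    lam f h = lam f k := by
  apply res_congr hf
  rw [← sub_mul]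
  exact hd.mul_right _

lemma lam_one (h : Polynomial Fq) : lam 1 h = 0 := by simp [lam, res]

lemma lam_mul {f g : Polynomial Fq} (hf : f.Monic) (hg : g.Monic) (h : Polynomial Fq) :
    lam (f * g) h = lam f h + lam g h := by
  rw [lam, derivative_mul, mul_add, res_add, ← mul_assoc, res_mul_right hf hg, mul_left_comm,
    mul_comm f (h * _), mul_comm f g, res_mul_right hg hf]
  rfl

lemma lam_multiset_prod (s : Multiset (Polynomial Fq)) (hs : ∀ P ∈ s, P.Monic)
    (h : Polynomial Fq) : lam s.prod h = (s.map (fun P => lam P h)).sum := by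
  induction s using Multiset.induction_on with
  | empty => simp [lam_one]
  | cons a s ih =>
    have hs' : ∀ P ∈ s, P.Monic := fun P hP => hs P (Multiset.mem_cons_of_mem hP)
    rw [Multiset.prod_cons, lam_mul (hs a (Multiset.mem_cons_self a s))
      (by simpa using monic_multiset_prod_of_monic s id (by simpa using hs')), ih hs']
    simp

end Residues

section Char2
variable {Fq : Type} [Field Fq] [Fintype Fq] [CharP Fq 2]

lemma exists_sqrt (c : Fq) : ∃ d : Fq, d ^ 2 = c := by
  obtain ⟨d, hd⟩ := (frobeniusEquiv Fq 2).surjective c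
  exact ⟨d, by simpa [frobeniusEquiv_apply, frobenius_def] using hd⟩

lemma exists_sq_decomp (f : Polynomial Fq) :
    ∃ a b : Polynomial Fq, f = a ^ 2 + X * b ^ 2 := by
  induction f using Polynomial.recOnHorner with
  | M0 => exact ⟨0, 0, by simp⟩
  | MC p c _ _ ih =>
    obtain ⟨a, b, rfl⟩ := ih
    obtain ⟨d, rfl⟩ := exists_sqrt c
    refine ⟨a + C d, b, ?_⟩
    rw [CharTwo.add_sq]; simp; ring
  | MX p _ ih =>
    obtain ⟨a, b, rfl⟩ := ih
    refine ⟨X * b, a, ?_⟩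
    ring

/-- The even part root. -/
def sqA (f : Polynomial Fq) : Polynomial Fq := (exists_sq_decomp f).choose
/-- The odd part root. -/
def sqB (f : Polynomial Fq) : Polynomial Fq := (exists_sq_decomp f).choose_spec.choose
lemma sq_decomp (f : Polynomial Fq) : f = sqA f ^ 2 + X * sqB f ^ 2 :=
  (exists_sq_decomp f).choose_spec.choose_spec

lemma derivative_sq_zero (a : Polynomial Fq) : derivative (a ^ 2) = 0 := by
  rw [sq, derivative_mul, mul_comm (derivative a), CharTwo.add_self_eq_zero]

lemma derivative_eq (f : Polynomial Fq) : derivative f = sqB f ^ 2 := by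
  conv_lhs => rw [sq_decomp f]
  rw [derivative_add, derivative_mul, derivative_sq_zero, derivative_sq_zero]
  simp

lemma sqB_eq_zero_iff (f : Polynomial Fq) : sqB f = 0 ↔ ∃ h, f = h ^ 2 := by
  constructor
  · intro h
    refine ⟨sqA f, ?_⟩
    conv_lhs => rw [sq_decomp f, h]
    simp
  · rintro ⟨h, hh⟩
    have := derivative_eq f
    rw [hh, derivative_sq_zero] at this
    rw [hh]
    exact pow_eq_zero_iff (two_ne_zero) |>.1 this.symm

lemma two_mul_natDegree_sqB (f : Polynomial Fq) (hb : sqB f ≠ 0) :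
    2 * (sqB f).natDegree + 1 ≤ f.natDegree := by
  have h := natDegree_derivative_le f
  rw [derivative_eq, natDegree_pow] at h
  have : f.natDegree ≠ 0 := by
    intro h0
    have : derivative f = 0 := derivative_of_natDegree_zero h0
    rw [derivative_eq] at this
    exact hb (pow_eq_zero_iff (two_ne_zero) |>.1 this)
  omega

lemma two_mul_natDegree_sqA (f : Polynomial Fq) : 2 * (sqA f).natDegree ≤ f.natDegree := by
  have h : sqA f ^ 2 = f - X * sqB f ^ 2 := by
    conv_rhs => enter [1]; rw [sq_decomp f]
    ring
  have h2 : (sqA f ^ 2).natDegree = 2 * (sqA f).natDegree := natDegree_pow _ _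
  rw [← h2, h]
  refine (natDegree_sub_le _ _).trans (max_le le_rfl ?_)
  by_cases hb : sqB f = 0
  · simp [hb]
  · refine natDegree_mul_le.trans ?_
    rw [natDegree_pow, natDegree_X]
    have := two_mul_natDegree_sqB f hb
    omega

lemma res_sq {f : Polynomial Fq} (hf : f.Monic) (y : Polynomial Fq) :
    res (f ^ 2) (y ^ 2) = 0 := by
  have h1 : res (f ^ 2) (y ^ 2) = res (f ^ 2) ((y %ₘ f) ^ 2) := by
    apply res_congr (hf.pow 2)
    conv_rhs => enter [1]; rw [← modByMonic_add_div y f]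
    rw [CharTwo.add_sq]
    exact ⟨(y /ₘ f) ^ 2, by ring⟩
  by_cases h0 : f = 1
  · subst h0; simp [res]
  have hd := natDegree_modByMonic_lt y hf h0
  have hlt : ((y %ₘ f) ^ 2).natDegree < (f ^ 2).natDegree := by
    rw [natDegree_pow, natDegree_pow]; omega
  rw [h1, res_of_lt (hf.pow 2) (degree_lt_degree hlt)]
  apply coeff_eq_zero_of_natDegree_lt
  rw [natDegree_pow, natDegree_pow]; omega

lemma res_X_sq {f : Polynomial Fq} (hf : f.Monic) (y : Polynomial Fq) :
    res (f ^ 2) (X * y ^ 2) = res f y ^ 2 := by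
  have h1 : res (f ^ 2) (X * y ^ 2) = res (f ^ 2) (X * (y %ₘ f) ^ 2) := by
    apply res_congr (hf.pow 2)
    conv_rhs => enter [1]; rw [← modByMonic_add_div y f]
    rw [CharTwo.add_sq]
    exact ⟨X * (y /ₘ f) ^ 2, by ring⟩
  by_cases h0 : f = 1
  · subst h0; simp [res]
  have hd := natDegree_modByMonic_lt y hf h0
  have hlt : (X * (y %ₘ f) ^ 2).natDegree < (f ^ 2).natDegree := by
    refine natDegree_mul_le.trans_lt ?_
    rw [natDegree_pow, natDegree_pow, natDegree_X]; omega
  rw [h1, res_of_lt (hf.pow 2) (degree_lt_degree hlt), natDegree_pow, res]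
  have : 2 * f.natDegree - 1 = ((f.natDegree - 1) + (f.natDegree - 1)) + 1 := by omega
  rw [this, coeff_X_mul, sq, coeff_mul_add_eq_of_natDegree_le (by omega) (by omega), sq]

lemma lam_sq {f : Polynomial Fq} (hf : f.Monic) (h : Polynomial Fq) :
    lam f (h ^ 2) = lam f h ^ 2 := by
  have e1 : lam f (h ^ 2) = res (f ^ 2) ((h ^ 2 * derivative f) * f) := by
    rw [sq f, res_mul_right hf hf]; rfl
  have e2 : (h ^ 2 * derivative f) * f
      = (h * sqB f * sqA f) ^ 2 + X * (h * sqB f ^ 2) ^ 2 := by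
    rw [derivative_eq]
    conv_lhs => rw [sq_decomp f]
    have : sqB (sqA f ^ 2 + X * sqB f ^ 2) = sqB f := by rw [← sq_decomp f]
    rw [this]; ring
  rw [e1, e2, res_add, res_sq hf, res_X_sq hf, zero_add, lam, derivative_eq]

lemma lam_surj {P : Polynomial Fq} (hP : P.Monic) (hi : Irreducible P) (t : Fq) :
    ∃ h, lam P h = t := by
  have hsep : P.Separable := PerfectField.separable_of_irreducible hi
  obtain ⟨u, v, huv⟩ := hsep
  have hd : 0 < P.natDegree := hi.natDegree_pos
  refine ⟨(C t * X ^ (P.natDegree - 1)) * v, ?_⟩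
  have : lam P ((C t * X ^ (P.natDegree - 1)) * v) = res P (C t * X ^ (P.natDegree - 1)) := by
    apply res_congr hP
    refine ⟨- (C t * X ^ (P.natDegree - 1)) * u, ?_⟩
    linear_combination (C t * X ^ (P.natDegree - 1)) * huv
  rw [this, res_C_mul, res_of_lt hP]
  · simp
  · rw [degree_X_pow, degree_eq_natDegree hP.ne_zero]
    exact_mod_cast Nat.sub_lt hd one_pos

end Char2

section Psi
variable {K : Type*} [Field K] [Finite K] [CharP K 2]

/-- Sign character of a finite field of characteristic 2, trivial on `y²+y`. -/
def psi (x : K) : ℤ := if ∃ y : K, y ^ 2 + y = x then 1 else -1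

lemma psi_add_aux {x y : K} (hx : ¬ ∃ z : K, z ^ 2 + z = x) (hy : ¬ ∃ z : K, z ^ 2 + z = y) :
    ∃ z : K, z ^ 2 + z = x + y := by
  let p : K →+ K :=
    { toFun := fun z => z ^ 2 + z
      map_zero' := by simp
      map_add' := fun a b => by rw [CharTwo.add_sq]; ring }
  have hker : Nat.card p.ker = 2 := by
    have : (p.ker : Set K) = {0, 1} := by
      ext z
      simp only [SetLike.mem_coe, AddMonoidHom.mem_ker, Set.mem_insert_iff, Set.mem_singleton_iff]
      change z ^ 2 + z = 0 ↔ _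
      have e : z ^ 2 + z = z * (z - 1) := by rw [CharTwo.sub_eq_add]; ring
      rw [e, mul_eq_zero, sub_eq_zero]
    rw [← SetLike.coe_sort_coe, this, Nat.card_coe_set_eq, Set.ncard_pair zero_ne_one]
  have h1 := AddSubgroup.card_mul_index p.ker
  rw [AddSubgroup.index_ker, hker] at h1
  have h2 := AddSubgroup.card_mul_index p.range
  have hpos : 0 < Nat.card p.range := Nat.card_pos
  have hidx : p.range.index = 2 := by
    have : Nat.card p.range * p.range.index = Nat.card p.range * 2 := by rw [h2, ← h1]; ring
    exact Nat.eq_of_mul_eq_mul_left hpos this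
  have := (AddSubgroup.add_mem_iff_of_index_two hidx (a := x) (b := y)).2
    ⟨fun h => absurd (AddMonoidHom.mem_range.1 h) hx,
     fun h => absurd (AddMonoidHom.mem_range.1 h) hy⟩
  exact AddMonoidHom.mem_range.1 this

lemma psi_add (x y : K) : psi (x + y) = psi x * psi y := by
  by_cases hx : ∃ z : K, z ^ 2 + z = x
  · obtain ⟨a, ha⟩ := hx
    have : (∃ z : K, z ^ 2 + z = x + y) ↔ ∃ z : K, z ^ 2 + z = y := by
      constructor
      · rintro ⟨z, hz⟩
        refine ⟨z + a, ?_⟩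
        rw [CharTwo.add_sq]
        have := CharTwo.add_self_eq_zero x
        linear_combination hz + ha + this
      · rintro ⟨z, hz⟩
        refine ⟨a + z, ?_⟩
        rw [CharTwo.add_sq]
        linear_combination hz + ha
    simp only [psi, this, if_pos (⟨a, ha⟩ : ∃ z : K, z ^ 2 + z = x), one_mul]
  · by_cases hy : ∃ z : K, z ^ 2 + z = y
    · obtain ⟨a, ha⟩ := hy
      have : (∃ z : K, z ^ 2 + z = x + y) ↔ ∃ z : K, z ^ 2 + z = x := by
        constructor
        · rintro ⟨z, hz⟩
          refine ⟨z + a, ?_⟩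
          rw [CharTwo.add_sq]
          have := CharTwo.add_self_eq_zero y
          linear_combination hz + ha + this
        · rintro ⟨z, hz⟩
          refine ⟨a + z, ?_⟩
          rw [CharTwo.add_sq]
          linear_combination hz + ha
      simp only [psi, this, if_pos (⟨a, ha⟩ : ∃ z : K, z ^ 2 + z = y), mul_one]
    · simp only [psi, if_pos (psi_add_aux hx hy), if_neg hx, if_neg hy]
      norm_num

lemma psi_zero : psi (0 : K) = 1 := if_pos ⟨0, by simp⟩

lemma psi_eq (x : K) : psi x = 1 ∨ psi x = -1 := by
  unfold psi; split_ifs <;> simp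

lemma psi_multiset_sum (s : Multiset K) : psi s.sum = (s.map psi).prod := by
  induction s using Multiset.induction_on with
  | empty => simp [psi_zero]
  | cons a s ih => simp [psi_add, ih]

end Psi
end EvenChar

namespace EvenChar
open scoped Classical
set_option linter.unusedSectionVars false

section Symbol
variable {Fq : Type} [Field Fq] [Fintype Fq]

lemma nf_monic {f P : Polynomial Fq} (hP : P ∈ normalizedFactors f) : P.Monic := by
  by_cases hf : f = 0
  · subst hf; simp at hP
  · exact ((Polynomial.mem_normalizedFactors_iff hf).1 hP).2.1

lemma nf_prod {f : Polynomial Fq} (hf : f.Monic) : (normalizedFactors f).prod = f := by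
  refine eq_of_monic_of_associated ?_ hf (prod_normalizedFactors hf.ne_zero)
  simpa using monic_multiset_prod_of_monic (normalizedFactors f) id (fun P hP => nf_monic hP)

variable [CharP Fq 2]

lemma psi_prime {P : Polynomial Fq} (hP : P.Monic) (hi : Irreducible P) (hξ : ∃ t : Fq, psi t = -1)
    (h : Polynomial Fq) :
    (if ∃ x : Polynomial Fq, P ∣ (x ^ 2 + x) - h then (1 : ℤ) else -1) = psi (lam P h) := by
  have : Fact (Irreducible P) := ⟨hi⟩
  have : Module.Finite Fq (AdjoinRoot P) := (AdjoinRoot.powerBasis hi.ne_zero).finite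
  have : Finite (AdjoinRoot P) := Module.finite_of_finite Fq
  have : CharP (AdjoinRoot P) 2 :=
    charP_of_injective_algebraMap (algebraMap Fq (AdjoinRoot P)).injective 2
  have key : ∀ g : Polynomial Fq, (∃ x : Polynomial Fq, P ∣ (x ^ 2 + x) - g) ↔
      ∃ y : AdjoinRoot P, y ^ 2 + y = AdjoinRoot.mk P g := by
    intro g
    constructor
    · rintro ⟨x, hx⟩
      refine ⟨AdjoinRoot.mk P x, ?_⟩
      have := AdjoinRoot.mk_eq_mk.2 hx
      simpa using this
    · rintro ⟨y, hy⟩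
      obtain ⟨x, rfl⟩ := AdjoinRoot.mk_surjective y
      refine ⟨x, ?_⟩
      apply AdjoinRoot.mk_eq_mk.1
      simpa using hy
  have one : ∀ g : Polynomial Fq, (∃ x : Polynomial Fq, P ∣ (x ^ 2 + x) - g) →
      psi (lam P g) = 1 := by
    rintro g ⟨x, hx⟩
    have := lam_congr hP hx
    rw [lam_add, lam_sq hP] at this
    exact if_pos ⟨_, this⟩
  split_ifs with hs
  · exact (one h hs).symm
  · obtain ⟨t, ht⟩ := hξ
    obtain ⟨g, rfl⟩ := lam_surj hP hi t
    have hg : ¬ ∃ x : Polynomial Fq, P ∣ (x ^ 2 + x) - g := by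
      intro hg
      have := one g hg
      omega
    rw [key] at hs hg
    have := psi_add_aux hs hg
    rw [← map_add, ← key] at this
    have := one _ this
    rw [lam_add, psi_add, ht] at this
    linarith

/-- `h` represents `u` modulo `f`. -/
def Rep (f : Polynomial Fq) (u : RatFunc Fq) (h : Polynomial Fq) : Prop :=
  ∃ n d : Polynomial Fq, IsCoprime f d ∧
    u * algebraMap (Polynomial Fq) (RatFunc Fq) d = algebraMap (Polynomial Fq) (RatFunc Fq) n ∧
    f ∣ h * d - n

lemma Rep.add {f : Polynomial Fq} {u v : RatFunc Fq} {h k : Polynomial Fq} (hu : Rep f u h)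
    (hv : Rep f v k) : Rep f (u + v) (h + k) := by
  obtain ⟨n, d, hc, he, hd⟩ := hu
  obtain ⟨n', d', hc', he', hd'⟩ := hv
  refine ⟨n * d' + n' * d, d * d', hc.mul_right hc', ?_, ?_⟩
  · simp only [map_mul, map_add, ← he, ← he']
    ring
  · have : (h + k) * (d * d') - (n * d' + n' * d) = (h * d - n) * d' + (k * d' - n') * d := by ring
    rw [this]
    exact dvd_add (hd.mul_right _) (hd'.mul_right _)

lemma Rep.poly (f G : Polynomial Fq) : Rep f (algebraMap (Polynomial Fq) (RatFunc Fq) G) G :=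
  ⟨G, 1, isCoprime_one_right, by simp, by simp⟩

lemma Rep.denom {f : Polynomial Fq} {u : RatFunc Fq} {h : Polynomial Fq}
    (hu : Rep f u h) : IsCoprime f u.denom ∧ f ∣ h * u.denom - u.num := by
  obtain ⟨n, d, hc, he, hd⟩ := hu
  have hn : u.num * d = n * u.denom := by
    have h1 : algebraMap (Polynomial Fq) (RatFunc Fq) u.denom ≠ 0 := by
      simpa using u.denom_ne_zero
    apply RatFunc.algebraMap_injective Fq
    rw [map_mul, map_mul, ← he]
    have := RatFunc.num_div_denom u
    rw [div_eq_iff h1] at this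
    rw [this]; ring
  have hdvd : u.denom ∣ d :=
    (RatFunc.isCoprime_num_denom u).symm.dvd_of_dvd_mul_left ⟨n, by rw [hn]; ring⟩
  refine ⟨hc.of_isCoprime_of_dvd_right hdvd, ?_⟩
  apply hc.dvd_of_dvd_mul_left
  have : d * (h * u.denom - u.num) = (h * d - n) * u.denom := by linear_combination -hn
  rw [this]
  exact hd.mul_right _

lemma quadSym_eq {f : Polynomial Fq} (hf : f.Monic) (hξ : ∃ t : Fq, psi t = -1) {u : RatFunc Fq}
    {h : Polynomial Fq} (hu : Rep f u h) : quadSym u f = psi (lam f h) := by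
  obtain ⟨hc, hd⟩ := hu.denom
  rw [quadSym, if_pos hc]
  conv_rhs => rw [← nf_prod hf]
  rw [lam_multiset_prod _ (fun P hP => nf_monic hP), psi_multiset_sum, Multiset.map_map]
  congr 1
  apply Multiset.map_congr rfl
  intro P hP
  have hi := irreducible_of_normalized_factor P hP
  have hPf : P ∣ f := dvd_of_mem_normalizedFactors hP
  rw [Function.comp, ← psi_prime (nf_monic hP) hi hξ h]
  have : hasseSolvable u P ↔ ∃ x : Polynomial Fq, P ∣ (x ^ 2 + x) - h := by
    have hPd : IsCoprime P u.denom := hc.of_isCoprime_of_dvd_left hPf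
    unfold hasseSolvable
    refine exists_congr fun x => ?_
    have e : ((x ^ 2 + x) * u.denom - u.num) = u.denom * ((x ^ 2 + x) - h)
        + (h * u.denom - u.num) := by ring
    rw [e, dvd_add_left (hPf.trans hd)]
    exact ⟨fun hh => hPd.dvd_of_dvd_mul_left hh, fun hh => hh.mul_left _⟩
  simp only [this]

lemma exists_Rep {f : Polynomial Fq} {u : RatFunc Fq} (hc : IsCoprime f u.denom) :
    ∃ h, Rep f u h := by
  obtain ⟨a, b, hab⟩ := id hc
  refine ⟨u.num * b, u.num, u.denom, hc, ?_, ⟨- (u.num * a), ?_⟩⟩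
  · have h1 : algebraMap (Polynomial Fq) (RatFunc Fq) u.denom ≠ 0 := by
      simpa using u.denom_ne_zero
    have := RatFunc.num_div_denom u
    rw [div_eq_iff h1] at this
    exact this.symm
  · linear_combination u.num * hab

lemma quadSym_of_not {f : Polynomial Fq} {u : RatFunc Fq} (hc : ¬ IsCoprime f u.denom) :
    quadSym u f = 0 := if_neg hc

/-- Key nontriviality: a prime power not dividing `sqB f` is detected. -/
lemma exists_detect {f Q : Polynomial Fq} (hf : f.Monic) (hQ : Q.Monic) (hi : Irreducible Q)
    (hfQ : IsCoprime f Q) (i : ℕ) (h1 : Q ^ i ∣ sqB f) (h2 : ¬ Q ^ (i + 1) ∣ sqB f) (c : Fq) :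
    ∃ A h : Polynomial Fq, A.degree < Q.degree ∧
      Rep f (algebraMap (Polynomial Fq) (RatFunc Fq) A /
        algebraMap (Polynomial Fq) (RatFunc Fq) Q ^ (2 * i + 1)) h ∧ lam f h = c := by
  obtain ⟨b, hb⟩ := h1
  have hQb : ¬ Q ∣ b := by
    rintro ⟨w, rfl⟩
    exact h2 ⟨w, by rw [hb]; ring⟩
  have hb0 : b ≠ 0 := by rintro rfl; simp at hQb
  have hB0 : sqB f ≠ 0 := by rw [hb]; exact mul_ne_zero (pow_ne_zero _ hQ.ne_zero) hb0
  have hcop : IsCoprime (b ^ 2) Q := by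
    apply IsCoprime.pow_left
    exact ((Irreducible.coprime_iff_not_dvd hi).2 hQb).symm
  obtain ⟨s, t, hst⟩ := hcop
  set Y : Polynomial Fq := C c * X ^ (Q.natDegree - 1) with hY
  set A := (f * Y * s) %ₘ Q with hA
  have hAd : A.degree < Q.degree := degree_modByMonic_lt _ hQ
  have hA1 : A + Q * ((f * Y * s) /ₘ Q) = f * Y * s := modByMonic_add_div _ _
  obtain ⟨Z, hZ⟩ : ∃ Z, A * b ^ 2 = f * Y + Q * Z := by
    refine ⟨- ((f * Y * s) /ₘ Q) * b ^ 2 - f * Y * t, ?_⟩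
    linear_combination b ^ 2 * hA1 + f * Y * hst
  have hcop2 : IsCoprime f (Q ^ (2 * i + 1)) := hfQ.pow_right
  obtain ⟨a', b', hab⟩ := id hcop2
  have hQ0 : algebraMap (Polynomial Fq) (RatFunc Fq) Q ≠ 0 := by
    simpa using hQ.ne_zero
  have hrep : f ∣ (A * b') * Q ^ (2 * i + 1) - A := ⟨-(A * a'), by linear_combination A * hab⟩
  refine ⟨A, A * b', hAd, ⟨A, Q ^ (2 * i + 1), hcop2, ?_, hrep⟩, ?_⟩
  · rw [map_pow, div_mul_cancel₀ _ (pow_ne_zero _ hQ0)]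
  · have e1 : lam f (A * b') = res f Z := by
      apply res_congr hf
      apply hcop2.dvd_of_dvd_mul_left
      rw [derivative_eq, hb]
      have : Q ^ (2 * i + 1) * (A * b' * (Q ^ i * b) ^ 2 - Z) =
          ((A * b') * Q ^ (2 * i + 1) - A) * (Q ^ i * b) ^ 2
          + f * (Q ^ (2 * i) * Y) + (Q ^ (2 * i + 1) * Z - Q ^ (2 * i + 1) * Z) := by
        linear_combination Q ^ (2 * i) * hZ
      rw [this, sub_self, add_zero]
      exact dvd_add (hrep.mul_right _) (dvd_mul_right _ _)
    have hdQ : 0 < Q.natDegree := hi.natDegree_pos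
    have hdf := two_mul_natDegree_sqB f hB0
    rw [hb, natDegree_mul (pow_ne_zero _ hQ.ne_zero) hb0, natDegree_pow] at hdf
    have hAn : A.natDegree < Q.natDegree := by
      apply natDegree_modByMonic_lt _ hQ
      rintro rfl; simp at hdQ
    have hZc : Z * Q = A * b ^ 2 - f * Y := by rw [hZ]; ring
    have hY1 : Y.natDegree ≤ Q.natDegree - 1 := by
      rw [hY]; exact natDegree_C_mul_X_pow_le _ _
    have hn1 : (A * b ^ 2).natDegree < f.natDegree + (Q.natDegree - 1) := by
      refine natDegree_mul_le.trans_lt ?_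
      rw [natDegree_pow]
      have : b.natDegree ≤ i * Q.natDegree + b.natDegree := Nat.le_add_left _ _
      omega
    have hn2 : (f * Y).natDegree ≤ f.natDegree + (Q.natDegree - 1) :=
      natDegree_mul_le.trans (by omega)
    have hlt : (Z * Q).natDegree < (f * Q).natDegree := by
      rw [hZc, hf.natDegree_mul hQ]
      refine (natDegree_sub_le _ _).trans_lt (max_lt ?_ ?_) <;> omega
    rw [e1, ← res_mul_right hf hQ, res_of_lt (hf.mul hQ) (degree_lt_degree hlt), hZc, coeff_sub,
      hf.natDegree_mul hQ]
    have e3 : f.natDegree + Q.natDegree - 1 = f.natDegree + (Q.natDegree - 1) := by omega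
    rw [e3, coeff_eq_zero_of_natDegree_lt hn1, coeff_mul_add_eq_of_natDegree_le le_rfl hY1]
    simp [hf, hY, CharTwo.neg_eq]

lemma lam_C {f : Polynomial Fq} (hf : f.Monic) (c : Fq) : lam f (C c) = c * f.natDegree := by
  by_cases h0 : f.natDegree = 0
  · have : f = 1 := hf.natDegree_eq_zero.1 h0
    subst this
    simp [lam_one]
  rw [lam, res_C_mul, res_of_lt hf (degree_derivative_lt hf.ne_zero), coeff_derivative]
  have : f.natDegree - 1 + 1 = f.natDegree := by omega
  rw [this, coeff_natDegree, hf]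
  have h2 : ((f.natDegree - 1 : ℕ) : Fq) + 1 = (f.natDegree : Fq) := by exact_mod_cast congrArg _ this
  rw [h2]; simp

lemma exists_detect_inf {f : Polynomial Fq} (hf : f.Monic) (hB0 : sqB f ≠ 0)
    (k t : ℕ) (hk : f.natDegree = 2 * k) (ht : (sqB f).natDegree + t = k) (ht1 : 1 ≤ t)
    (c : Fq) : ∃ c', lam f (C c' * X ^ (2 * t - 1)) = c := by
  refine ⟨c / (sqB f).leadingCoeff ^ 2, ?_⟩
  have hl : (sqB f).leadingCoeff ≠ 0 := leadingCoeff_ne_zero.2 hB0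
  have hdeg : (X ^ (2 * t - 1) * sqB f ^ 2).natDegree = 2 * k - 1 := by
    rw [natDegree_mul (by simp) (pow_ne_zero _ hB0), natDegree_X_pow, natDegree_pow]
    omega
  rw [lam, mul_assoc, res_C_mul, derivative_eq, res_of_lt hf
    (degree_lt_degree (by rw [hdeg, hk]; omega)), hk, ← hdeg, coeff_natDegree]
  simp [hl]

end Symbol
end EvenChar

namespace EvenChar
open scoped Classical
set_option linter.unusedSectionVars false

section Counting
variable {Fq : Type} [Field Fq] [Fintype Fq]

lemma finite_degreeLT (n : ℕ) : ((degreeLT Fq n : Submodule Fq (Polynomial Fq)) :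
    Set (Polynomial Fq)).Finite := by
  have : Finite (degreeLT Fq n) := Finite.of_equiv _ (degreeLTEquiv Fq n).symm.toEquiv
  exact Set.toFinite _

variable (Fq) in
/-- Polynomials of degree `< n`. -/
def polysLT (n : ℕ) : Finset (Polynomial Fq) := (finite_degreeLT n).toFinset

lemma mem_polysLT {n : ℕ} {f : Polynomial Fq} : f ∈ polysLT Fq n ↔ f.degree < n := by
  simp [polysLT, mem_degreeLT]

lemma mem_polysLT_succ {n : ℕ} {f : Polynomial Fq} :
    f ∈ polysLT Fq (n + 1) ↔ f.natDegree ≤ n := by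
  rw [mem_polysLT]
  by_cases h : f = 0
  · subst h; simp
  · rw [← natDegree_lt_iff_degree_lt h]; omega

variable (Fq) in
lemma card_polysLT (n : ℕ) : (polysLT Fq n).card = Fintype.card Fq ^ n := by
  rw [polysLT, ← Set.ncard_eq_toFinset_card _ (finite_degreeLT n), ← Nat.card_coe_set_eq]
  change Nat.card (degreeLT Fq n) = _
  rw [Nat.card_congr (degreeLTEquiv Fq n).toEquiv]
  simp

variable (Fq) in
/-- Monic polynomials of degree `n`. -/
def Mon (n : ℕ) : Finset (Polynomial Fq) := (polysLT Fq n).image (fun f => X ^ n + f)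

lemma mem_Mon {n : ℕ} {f : Polynomial Fq} : f ∈ Mon Fq n ↔ f.Monic ∧ f.natDegree = n := by
  simp only [Mon, Finset.mem_image, mem_polysLT]
  constructor
  · rintro ⟨g, hg, rfl⟩
    refine ⟨monic_X_pow_add hg, ?_⟩
    apply natDegree_eq_of_degree_eq_some
    rw [degree_add_eq_left_of_degree_lt] <;> simp [hg]
  · rintro ⟨hf, rfl⟩
    refine ⟨f - X ^ f.natDegree, ?_, by ring⟩
    have := degree_sub_lt_left (p := f) (q := X ^ f.natDegree) (by simp [degree_eq_natDegree hf.ne_zero])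
      hf.ne_zero (by simp [hf.leadingCoeff])
    rwa [degree_eq_natDegree hf.ne_zero] at this

variable (Fq) in
lemma card_Mon (n : ℕ) : (Mon Fq n).card = Fintype.card Fq ^ n := by
  rw [Mon, Finset.card_image_of_injective _ (add_right_injective _), card_polysLT]

lemma Mon_zero : Mon Fq 0 = {1} := by
  ext f
  rw [mem_Mon, Finset.mem_singleton]
  constructor
  · rintro ⟨h1, h2⟩; exact h1.natDegree_eq_zero.1 h2
  · rintro rfl; simp

lemma Mon_filter_dvd {D : Polynomial Fq} {i : ℕ} (hD : D ∈ Mon Fq i) (j : ℕ) :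
    (Mon Fq (i + j)).filter (D ∣ ·) = (Mon Fq j).image (D * ·) := by
  rw [mem_Mon] at hD
  ext f
  simp only [Finset.mem_filter, Finset.mem_image, mem_Mon]
  constructor
  · rintro ⟨⟨hf, hd⟩, g, rfl⟩
    have hg := hD.1.of_mul_monic_left hf
    refine ⟨g, ⟨hg, ?_⟩, rfl⟩
    rw [hD.1.natDegree_mul hg, hD.2] at hd
    omega
  · rintro ⟨g, ⟨hg, rfl⟩, rfl⟩
    exact ⟨⟨hD.1.mul hg, by rw [hD.1.natDegree_mul hg, hD.2]⟩, dvd_mul_right _ _⟩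

lemma card_Mon_filter_dvd {D : Polynomial Fq} {i n : ℕ} (hD : D ∈ Mon Fq i) (h : i ≤ n) :
    ((Mon Fq n).filter (D ∣ ·)).card = Fintype.card Fq ^ (n - i) := by
  obtain ⟨j, rfl⟩ := Nat.exists_eq_add_of_le h
  rw [Mon_filter_dvd hD, Finset.card_image_of_injective, card_Mon]
  · simp
  · exact mul_right_injective₀ (mem_Mon.1 hD).1.ne_zero

lemma Mon_filter_dvd_empty {D : Polynomial Fq} {n : ℕ} (h : n < D.natDegree) :
    (Mon Fq n).filter (D ∣ ·) = ∅ := by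
  rw [Finset.filter_eq_empty_iff]
  intro f hf hd
  rw [mem_Mon] at hf
  have := natDegree_le_of_dvd hd hf.1.ne_zero
  omega

/-- Monic divisors. -/
def divs (N : Polynomial Fq) : Finset (Polynomial Fq) :=
  ((Finset.range (N.natDegree + 1)).biUnion (Mon Fq)).filter (· ∣ N)

lemma mem_divs {N D : Polynomial Fq} (hN : N.Monic) : D ∈ divs N ↔ D.Monic ∧ D ∣ N := by
  simp only [divs, Finset.mem_filter, Finset.mem_biUnion, Finset.mem_range, mem_Mon]
  constructor
  · rintro ⟨⟨i, _, h, _⟩, hd⟩; exact ⟨h, hd⟩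
  · rintro ⟨h, hd⟩
    exact ⟨⟨_, Nat.lt_succ_of_le (natDegree_le_of_dvd hd hN.ne_zero), h, rfl⟩, hd⟩

end Counting

section Data
variable {Fq : Type} [Field Fq] [Fintype Fq]

/-- Index set of prime power indices dividing `N`. -/
def Jset (N : Polynomial Fq) : Finset (Σ _ : Polynomial Fq, ℕ) :=
  (normalizedFactors N).toFinset.sigma (fun P => Finset.range ((normalizedFactors N).count P))

lemma mem_Jset {N : Polynomial Fq} (hN : N.Monic) {j : Σ _ : Polynomial Fq, ℕ} :
    j ∈ Jset N ↔ j.1.Monic ∧ Irreducible j.1 ∧ j.1 ^ (j.2 + 1) ∣ N := by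
  obtain ⟨P, i⟩ := j
  simp only [Jset, Finset.mem_sigma, Multiset.mem_toFinset, Finset.mem_range,
    Polynomial.mem_normalizedFactors_iff hN.ne_zero]
  have key : P.Monic → Irreducible P →
      (i < (normalizedFactors N).count P ↔ P ^ (i + 1) ∣ N) := by
    intro hm hi
    have := emultiplicity_eq_count_normalizedFactors hi hN.ne_zero
    rw [hm.normalize_eq_self] at this
    rw [pow_dvd_iff_le_emultiplicity, this]
    norm_cast
  constructor
  · rintro ⟨⟨h1, h2, _⟩, h4⟩
    exact ⟨h2, h1, (key h2 h1).1 h4⟩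
  · rintro ⟨h1, h2, h3⟩
    exact ⟨⟨h2, h1, (dvd_pow_self P (Nat.succ_ne_zero i)).trans h3⟩, (key h1 h2).2 h3⟩

lemma sum_Jset {N : Polynomial Fq} (hN : N.Monic) :
    ∑ j ∈ Jset N, j.1.natDegree = N.natDegree := by
  rw [Jset, Finset.sum_sigma]
  conv_rhs => rw [← nf_prod hN]
  rw [natDegree_multiset_prod_of_monic _ (fun P hP => nf_monic hP), Finset.sum_multiset_map_count]
  simp

/-- Raw coefficient data. -/
abbrev Coef (Fq : Type) [Field Fq] : Type := (Σ _ : Polynomial Fq, ℕ) →₀ Polynomial Fq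

/-- Admissible coefficient data. -/
def isX (c : Coef Fq) : Prop :=
  ∀ j ∈ c.support, j.1.Monic ∧ Irreducible j.1 ∧ (c j).degree < j.1.degree

/-- Data supported at prime powers dividing `N`. -/
def XN (N : Polynomial Fq) : Finset (Coef Fq) :=
  (Jset N).finsupp (fun j => polysLT Fq j.1.natDegree)

lemma mem_XN {N : Polynomial Fq} (hN : N.Monic) {c : Coef Fq} :
    c ∈ XN N ↔ isX c ∧ ∀ j ∈ c.support, j.1 ^ (j.2 + 1) ∣ N := by
  rw [XN, Finset.mem_finsupp_iff]
  constructor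
  · rintro ⟨h1, h2⟩
    refine ⟨fun j hj => ?_, fun j hj => ((mem_Jset hN).1 (h1 hj)).2.2⟩
    have := (mem_Jset hN).1 (h1 hj)
    refine ⟨this.1, this.2.1, ?_⟩
    rw [degree_eq_natDegree this.1.ne_zero]
    exact mem_polysLT.1 (h2 j (h1 hj))
  · rintro ⟨h1, h2⟩
    refine ⟨fun j hj => (mem_Jset hN).2 ⟨(h1 j hj).1, (h1 j hj).2.1, h2 j hj⟩, fun j _ => ?_⟩
    rw [mem_polysLT]
    by_cases hj : j ∈ c.support
    · rw [← degree_eq_natDegree (h1 j hj).1.ne_zero]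
      exact (h1 j hj).2.2
    · rw [Finsupp.notMem_support_iff.1 hj]
      simp

lemma card_XN {N : Polynomial Fq} (hN : N.Monic) :
    (XN N).card = Fintype.card Fq ^ N.natDegree := by
  rw [XN, Finset.card_finsupp]
  simp only [card_polysLT]
  rw [Finset.prod_pow_eq_pow_sum, sum_Jset hN]

lemma isX.add {c d : Coef Fq} (hc : isX c) (hd : isX d) : isX (c + d) := by
  intro j hj
  by_cases h1 : j ∈ c.support
  · by_cases h2 : j ∈ d.support
    · exact ⟨(hc j h1).1, (hc j h1).2.1,
        (degree_add_le _ _).trans_lt (max_lt (hc j h1).2.2 (hd j h2).2.2)⟩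
    · rw [Finsupp.notMem_support_iff] at h2
      refine ⟨(hc j h1).1, (hc j h1).2.1, ?_⟩
      rw [Finsupp.add_apply, h2, add_zero]; exact (hc j h1).2.2
  · rw [Finsupp.notMem_support_iff] at h1
    have h2 : j ∈ d.support := by
      rw [Finsupp.mem_support_iff, Finsupp.add_apply, h1, zero_add] at hj
      exact Finsupp.mem_support_iff.2 hj
    refine ⟨(hd j h2).1, (hd j h2).2.1, ?_⟩
    rw [Finsupp.add_apply, h1, zero_add]; exact (hd j h2).2.2

lemma XN_add {N : Polynomial Fq} (hN : N.Monic) {c d : Coef Fq} (hc : c ∈ XN N) (hd : d ∈ XN N) :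
    c + d ∈ XN N := by
  rw [mem_XN hN] at *
  refine ⟨hc.1.add hd.1, fun j hj => ?_⟩
  rcases Finset.mem_union.1 (Finsupp.support_add hj) with h | h
  · exact hc.2 j h
  · exact hd.2 j h

/-- Exponent of `P` in the conductor. -/
def expo (c : Coef Fq) (P : Polynomial Fq) : ℕ :=
  (c.support.filter (fun j => j.1 = P)).sup (fun j => j.2 + 1)

/-- Conductor. -/
def cond (c : Coef Fq) : Polynomial Fq :=
  ∏ P ∈ c.support.image Sigma.fst, P ^ expo c P

lemma expo_spec {c : Coef Fq} {P : Polynomial Fq} (hP : P ∈ c.support.image Sigma.fst) :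
    ∃ i, (⟨P, i⟩ : Σ _ : Polynomial Fq, ℕ) ∈ c.support ∧ expo c P = i + 1 := by
  obtain ⟨j, hj, rfl⟩ := Finset.mem_image.1 hP
  have hne : (c.support.filter (fun j' => j'.1 = j.1)).Nonempty :=
    ⟨j, Finset.mem_filter.2 ⟨hj, rfl⟩⟩
  obtain ⟨k, hk, hk2⟩ := Finset.exists_mem_eq_sup _ hne (fun j => j.2 + 1)
  rw [Finset.mem_filter] at hk
  refine ⟨k.2, ?_, hk2⟩
  rw [← hk.2]; exact hk.1

lemma le_expo {c : Coef Fq} {j : Σ _ : Polynomial Fq, ℕ} (hj : j ∈ c.support) :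
    j.2 + 1 ≤ expo c j.1 :=
  Finset.le_sup (f := fun j : Σ _ : Polynomial Fq, ℕ => j.2 + 1)
    (Finset.mem_filter.2 ⟨hj, rfl⟩)

lemma isX.prime {c : Coef Fq} (hc : isX c) {P : Polynomial Fq}
    (hP : P ∈ c.support.image Sigma.fst) : P.Monic ∧ Irreducible P := by
  obtain ⟨j, hj, rfl⟩ := Finset.mem_image.1 hP
  exact ⟨(hc j hj).1, (hc j hj).2.1⟩

lemma cond_monic {c : Coef Fq} (hc : isX c) : (cond c).Monic :=
  monic_prod_of_monic _ _ (fun P hP => (hc.prime hP).1.pow _)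

lemma coprime_of_ne {P Q : Polynomial Fq} (hP : P.Monic) (hQ : Q.Monic) (hPi : Irreducible P)
    (hQi : Irreducible Q) (h : P ≠ Q) : IsCoprime P Q := by
  rw [Irreducible.coprime_iff_not_dvd hPi]
  intro hd
  exact h (eq_of_monic_of_associated hP hQ (hPi.associated_of_dvd hQi hd))

lemma cond_dvd_iff {c : Coef Fq} (hc : isX c) (N : Polynomial Fq) :
    cond c ∣ N ↔ ∀ j ∈ c.support, j.1 ^ (j.2 + 1) ∣ N := by
  constructor
  · intro h j hj
    refine (pow_dvd_pow _ (le_expo hj)).trans (dvd_trans ?_ h)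
    exact Finset.dvd_prod_of_mem (fun P => P ^ expo c P) (Finset.mem_image_of_mem _ hj)
  · intro h
    apply Finset.prod_dvd_of_coprime
    · intro P hP Q hQ hne
      have hP' := hc.prime (Finset.mem_coe.1 hP)
      have hQ' := hc.prime (Finset.mem_coe.1 hQ)
      have := coprime_of_ne hP'.1 hQ'.1 hP'.2 hQ'.2 hne
      show IsCoprime (P ^ expo c P) (Q ^ expo c Q)
      exact IsCoprime.pow this
    · intro P hP
      obtain ⟨i, hi, he⟩ := expo_spec hP
      have h3 : P ^ (i + 1) ∣ N := h ⟨P, i⟩ hi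
      show P ^ expo c P ∣ N
      rw [he]
      exact h3

lemma mem_XN' {N : Polynomial Fq} (hN : N.Monic) {c : Coef Fq} :
    c ∈ XN N ↔ isX c ∧ cond c ∣ N := by
  rw [mem_XN hN]
  constructor
  · rintro ⟨h1, h2⟩; exact ⟨h1, (cond_dvd_iff h1 N).2 h2⟩
  · rintro ⟨h1, h2⟩; exact ⟨h1, (cond_dvd_iff h1 N).1 h2⟩

variable (Fq) in
/-- Data with conductor of degree `n`. -/
def Cset (n : ℕ) : Finset (Coef Fq) :=
  ((Mon Fq n).biUnion XN).filter (fun c => (cond c).natDegree = n)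

lemma mem_Cset {n : ℕ} {c : Coef Fq} : c ∈ Cset Fq n ↔ isX c ∧ (cond c).natDegree = n := by
  simp only [Cset, Finset.mem_filter, Finset.mem_biUnion]
  constructor
  · rintro ⟨⟨N, hN, hc⟩, h⟩
    exact ⟨((mem_XN (mem_Mon.1 hN).1).1 hc).1, h⟩
  · rintro ⟨h1, h2⟩
    refine ⟨⟨cond c, mem_Mon.2 ⟨cond_monic h1, h2⟩, ?_⟩, h2⟩
    exact (mem_XN' (cond_monic h1)).2 ⟨h1, dvd_rfl⟩

lemma sum_XN (n : ℕ) (Ψ : Coef Fq → ℝ) :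
    ∑ N ∈ Mon Fq n, ∑ c ∈ XN N, Ψ c =
      ∑ i ∈ Finset.range (n + 1), (Fintype.card Fq : ℝ) ^ (n - i) * ∑ c ∈ Cset Fq i, Ψ c := by
  have h1 : ∀ N ∈ Mon Fq n, ∑ c ∈ XN N, Ψ c =
      ∑ i ∈ Finset.range (n + 1), ∑ c ∈ Cset Fq i, if cond c ∣ N then Ψ c else 0 := by
    intro N hN
    have hN' := mem_Mon.1 hN
    rw [← Finset.sum_fiberwise_of_maps_to (s := XN N) (t := Finset.range (n + 1))
      (g := fun c => (cond c).natDegree)]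
    · refine Finset.sum_congr rfl fun i _ => ?_
      rw [← Finset.sum_filter]
      refine Finset.sum_congr ?_ fun _ _ => rfl
      ext c
      rw [Finset.mem_filter, Finset.mem_filter, mem_XN' hN'.1, mem_Cset]
      tauto
    · intro c hc
      rw [mem_XN' hN'.1] at hc
      have := natDegree_le_of_dvd hc.2 hN'.1.ne_zero
      rw [Finset.mem_range]; omega
  rw [Finset.sum_congr rfl h1, Finset.sum_comm]
  refine Finset.sum_congr rfl fun i hi => ?_
  rw [Finset.sum_comm, Finset.mul_sum]
  refine Finset.sum_congr rfl fun c hc => ?_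
  rw [mem_Cset] at hc
  rw [← Finset.sum_filter, Finset.sum_const, card_Mon_filter_dvd (i := i)
    (mem_Mon.2 ⟨cond_monic hc.1, hc.2⟩) (by rw [Finset.mem_range] at hi; omega), nsmul_eq_mul]
  push_cast
  rfl

lemma sum_Cset_zero (Ψ : Coef Fq → ℝ) :
    ∑ c ∈ Cset Fq 0, Ψ c = ∑ N ∈ Mon Fq 0, ∑ c ∈ XN N, Ψ c := by
  rw [sum_XN]; simp

lemma sum_Cset_succ (n : ℕ) (Ψ : Coef Fq → ℝ) :
    ∑ c ∈ Cset Fq (n + 1), Ψ c = (∑ N ∈ Mon Fq (n + 1), ∑ c ∈ XN N, Ψ c)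
      - (Fintype.card Fq : ℝ) * ∑ N ∈ Mon Fq n, ∑ c ∈ XN N, Ψ c := by
  rw [sum_XN, sum_XN, Finset.sum_range_succ _ (n + 1)]
  have : ∀ i ∈ Finset.range (n + 1), (Fintype.card Fq : ℝ) ^ (n + 1 - i) * ∑ c ∈ Cset Fq i, Ψ c
      = (Fintype.card Fq : ℝ) * ((Fintype.card Fq : ℝ) ^ (n - i) * ∑ c ∈ Cset Fq i, Ψ c) := by
    intro i hi
    rw [Finset.mem_range] at hi
    have : n + 1 - i = (n - i) + 1 := by omega
    rw [this, pow_succ]; ring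
  rw [Finset.sum_congr rfl this, ← Finset.mul_sum]
  simp

/-- Euler function: number of data with conductor `N`. -/
def phi (N : Polynomial Fq) : ℕ := ((XN N).filter (fun c => cond c = N)).card

lemma sum_phi_divs {N : Polynomial Fq} (hN : N.Monic) :
    ∑ D ∈ divs N, (phi D : ℝ) = (Fintype.card Fq : ℝ) ^ N.natDegree := by
  have h := card_XN hN
  rw [Finset.card_eq_sum_card_fiberwise (f := cond) (t := divs N)] at h
  · rw [← Nat.cast_pow, ← h]
    push_cast
    refine Finset.sum_congr rfl fun D hD => ?_
    rw [mem_divs hN] at hD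
    have he : (XN D).filter (fun c => cond c = D) = (XN N).filter (fun c => cond c = D) := by
      ext c
      rw [Finset.mem_filter, Finset.mem_filter, mem_XN' hN, mem_XN' hD.1]
      constructor
      · rintro ⟨⟨h1, h2⟩, rfl⟩; exact ⟨⟨h1, hD.2⟩, rfl⟩
      · rintro ⟨⟨h1, h2⟩, rfl⟩; exact ⟨⟨h1, dvd_rfl⟩, rfl⟩
    rw [phi, he]
  · intro c hc
    rw [Finset.mem_coe, mem_XN' hN] at hc
    rw [Finset.mem_coe, mem_divs hN]
    exact ⟨cond_monic hc.1, hc.2⟩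

lemma sum_Cset_cond (n : ℕ) (g : Polynomial Fq → ℝ) :
    ∑ c ∈ Cset Fq n, g (cond c) = ∑ N ∈ Mon Fq n, (phi N : ℝ) * g N := by
  rw [← Finset.sum_fiberwise_of_maps_to (s := Cset Fq n) (t := Mon Fq n) (g := cond)]
  · refine Finset.sum_congr rfl fun N hN => ?_
    have hN' := mem_Mon.1 hN
    rw [Finset.sum_congr rfl (g := fun _ => g N)
      (fun c hc => by rw [(Finset.mem_filter.1 hc).2]), Finset.sum_const, nsmul_eq_mul]
    have he : (XN N).filter (fun c => cond c = N) = (Cset Fq n).filter (fun c => cond c = N) := by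
      ext c
      rw [Finset.mem_filter, Finset.mem_filter, mem_XN' hN'.1, mem_Cset]
      constructor
      · rintro ⟨⟨h1, h2⟩, rfl⟩; exact ⟨⟨h1, hN'.2⟩, rfl⟩
      · rintro ⟨⟨h1, h2⟩, rfl⟩; exact ⟨⟨h1, dvd_rfl⟩, rfl⟩
    rw [phi, he]
  · intro c hc
    rw [mem_Cset] at hc
    exact mem_Mon.2 ⟨cond_monic hc.1, hc.2⟩

lemma card_Cset_succ (n : ℕ) : ((Cset Fq (n + 1)).card : ℝ) =
    (Fintype.card Fq : ℝ) ^ (2 * (n + 1)) * (1 - (Fintype.card Fq : ℝ)⁻¹) := by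
  have h := sum_Cset_succ (Fq := Fq) n (fun _ => 1)
  have h2 : ∀ m, ∑ N ∈ Mon Fq m, ∑ c ∈ XN N, (1 : ℝ) = (Fintype.card Fq : ℝ) ^ (2 * m) := by
    intro m
    rw [Finset.sum_congr rfl (g := fun _ => (Fintype.card Fq : ℝ) ^ m)]
    · rw [Finset.sum_const, card_Mon, nsmul_eq_mul]; push_cast; ring
    · intro N hN
      have hN' := mem_Mon.1 hN
      rw [Finset.sum_const, card_XN hN'.1, hN'.2]; simp
  rw [h2, h2] at h
  simp only [Finset.sum_const, nsmul_eq_mul, mul_one] at h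
  rw [h]
  have : (Fintype.card Fq : ℝ) ≠ 0 := by exact_mod_cast Fintype.card_ne_zero
  field_simp
  ring

lemma card_Cset_zero : ((Cset Fq 0).card : ℝ) = 1 := by
  have h := sum_Cset_zero (Fq := Fq) (fun _ => 1)
  simp only [Finset.sum_const, nsmul_eq_mul, mul_one] at h
  rw [h, Mon_zero, Finset.sum_singleton, card_XN monic_one]
  simp

end Data
end EvenChar

namespace EvenChar
open scoped Classical
set_option linter.unusedSectionVars false

section USec
variable {Fq : Type} [Field Fq] [Fintype Fq] [CharP Fq 2]

/-- The rational function attached to coefficient data. -/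
def U (c : Coef Fq) : RatFunc Fq :=
  c.sum (fun j A => algebraMap (Polynomial Fq) (RatFunc Fq) A /
    algebraMap (Polynomial Fq) (RatFunc Fq) j.1 ^ (2 * j.2 + 1))

lemma U_add (c d : Coef Fq) : U (c + d) = U c + U d := by
  unfold U
  rw [Finsupp.sum_add_index']
  · intro j; simp
  · intro j a b; rw [map_add, add_div]

lemma U_single (j : Σ _ : Polynomial Fq, ℕ) (A : Polynomial Fq) :
    U (Finsupp.single j A) = algebraMap (Polynomial Fq) (RatFunc Fq) A /
    algebraMap (Polynomial Fq) (RatFunc Fq) j.1 ^ (2 * j.2 + 1) := by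
  unfold U
  rw [Finsupp.sum_single_index]; simp

lemma U_zero : U (0 : Coef Fq) = 0 := by simp [U]

instance : CharP (Polynomial Fq) 2 := inferInstance

lemma coef_add_self (c : Coef Fq) : c + c = 0 := by
  ext1 j
  exact CharTwo.add_self_eq_zero _

/-- Being divisible by `P` in the local ring at `P`. -/
def LocDvd (P : Polynomial Fq) (x : RatFunc Fq) : Prop :=
  ∃ n d : Polynomial Fq, ¬ P ∣ d ∧
    x * algebraMap (Polynomial Fq) (RatFunc Fq) d = algebraMap (Polynomial Fq) (RatFunc Fq) (P * n)

lemma LocDvd.add {P : Polynomial Fq} (hP : Irreducible P) {x y : RatFunc Fq} (hx : LocDvd P x)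
    (hy : LocDvd P y) : LocDvd P (x + y) := by
  obtain ⟨n, d, h1, h2⟩ := hx
  obtain ⟨n', d', h1', h2'⟩ := hy
  refine ⟨n * d' + n' * d, d * d', fun h => ?_, ?_⟩
  · rcases hP.prime.dvd_or_dvd h with h | h
    · exact h1 h
    · exact h1' h
  · have : P * (n * d' + n' * d) = (P * n) * d' + (P * n') * d := by ring
    rw [this, map_add, map_mul _ (P * n), map_mul _ (P * n'), ← h2, ← h2', map_mul]
    ring

lemma LocDvd.zero {P : Polynomial Fq} (hP : Irreducible P) : LocDvd P (0 : RatFunc Fq) :=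
  ⟨0, 1, fun h => hP.not_isUnit (isUnit_of_dvd_one h), by simp⟩

lemma LocDvd.sum {P : Polynomial Fq} (hP : Irreducible P) {β : Type} (s : Finset β)
    (g : β → RatFunc Fq) (h : ∀ j ∈ s, LocDvd P (g j)) : LocDvd P (∑ j ∈ s, g j) :=
  Finset.sum_induction _ (LocDvd P) (fun _ _ ha hb => ha.add hP hb) (LocDvd.zero hP) h

lemma LocDvd.poly {P : Polynomial Fq} (hP : Irreducible P) (n : Polynomial Fq) :
    LocDvd P (algebraMap (Polynomial Fq) (RatFunc Fq) (P * n)) :=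
  ⟨n, 1, fun h => hP.not_isUnit (isUnit_of_dvd_one h), by simp⟩

lemma dvd_denom {c : Coef Fq} (hc : isX c) (G : Polynomial Fq) {P : Polynomial Fq}
    (hP : P ∈ c.support.image Sigma.fst) :
    P ∣ (U c + algebraMap (Polynomial Fq) (RatFunc Fq) G).denom := by
  obtain ⟨hPm, hPi⟩ := hc.prime hP
  obtain ⟨i, hi, he⟩ := expo_spec hP
  set u := U c + algebraMap (Polynomial Fq) (RatFunc Fq) G with hu
  set ι := algebraMap (Polynomial Fq) (RatFunc Fq) with hι
  have hinj : Function.Injective ι := RatFunc.algebraMap_injective Fq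
  have hne : ∀ Q : Polynomial Fq, Q ≠ 0 → ι Q ≠ 0 := fun Q hQ h => hQ (hinj (by rw [h, map_zero]))
  set A := c ⟨P, i⟩ with hA
  have hA0 : A ≠ 0 := Finsupp.mem_support_iff.1 hi
  have hAP : ¬ P ∣ A := fun h => by
    have := degree_le_of_dvd h hA0
    exact absurd (hc _ hi).2.2 (not_lt.2 this)
  have key : LocDvd P (u * ι (P ^ (2 * i + 1)) - ι A) := by
    have e : u * ι (P ^ (2 * i + 1)) - ι A =
        (∑ j ∈ c.support.erase ⟨P, i⟩, (ι (c j) / ι j.1 ^ (2 * j.2 + 1)) * ι (P ^ (2 * i + 1)))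
          + ι (P * (P ^ (2 * i) * G)) := by
      rw [hu, U, Finsupp.sum, ← Finset.add_sum_erase _ _ hi, ← Finset.sum_mul, ← hι]
      have : ι (c ⟨P, i⟩) / ι P ^ (2 * i + 1) * ι (P ^ (2 * i + 1)) = ι A := by
        rw [map_pow, div_mul_cancel₀ _ (pow_ne_zero _ (hne P hPm.ne_zero))]
      have h2 : ι (P * (P ^ (2 * i) * G)) = ι (P ^ (2 * i + 1)) * ι G := by
        rw [← map_mul]; congr 1; ring
      rw [h2]
      linear_combination this
    rw [e]
    refine (LocDvd.sum hPi _ _ ?_).add hPi (LocDvd.poly hPi _)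
    intro j hj
    rw [Finset.mem_erase] at hj
    obtain ⟨hjne, hj⟩ := hj
    obtain ⟨hjm, hji, -⟩ := hc j hj
    by_cases h : j.1 = P
    · have hle := le_expo hj
      rw [h, he] at hle
      have hlt : j.2 < i := by
        rcases lt_or_eq_of_le (show j.2 ≤ i by omega) with h3 | h3
        · exact h3
        · exact absurd (show j = ⟨P, i⟩ from Sigma.ext h (heq_of_eq h3)) hjne
      have e2 : ι (c j) / ι j.1 ^ (2 * j.2 + 1) * ι (P ^ (2 * i + 1)) =
          ι (P * (P ^ (2 * (i - j.2) - 1) * c j)) := by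
        have : P ^ (2 * i + 1) = P ^ (2 * j.2 + 1) * (P * P ^ (2 * (i - j.2) - 1)) := by
          rw [← pow_succ', ← pow_add]; congr 1; omega
        rw [this, h, map_mul, map_pow, ← mul_assoc,
          div_mul_cancel₀ _ (pow_ne_zero _ (hne P hPm.ne_zero)), ← map_mul]
        congr 1; ring
      rw [e2]
      exact LocDvd.poly hPi _
    · refine ⟨c j * P ^ (2 * i), j.1 ^ (2 * j.2 + 1), fun hd => ?_, ?_⟩
      · have := hPi.prime.dvd_of_dvd_pow hd
        exact h (eq_of_monic_of_associated hPm hjm (hPi.associated_of_dvd hji this)).symm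
      · have h2 : ι j.1 ^ (2 * j.2 + 1) ≠ 0 := pow_ne_zero _ (hne _ hjm.ne_zero)
        rw [← hι, map_pow ι j.1]
        have h3 : P * (c j * P ^ (2 * i)) = c j * P ^ (2 * i + 1) := by ring
        rw [h3, map_mul]
        field_simp
  by_contra hD
  obtain ⟨n, d, hd, hx⟩ := key
  have h1 : ι u.denom ≠ 0 := hne _ u.denom_ne_zero
  have h2 := RatFunc.num_div_denom u
  rw [div_eq_iff h1] at h2
  rw [← hι] at h2 hx
  have h3 : u.num * P ^ (2 * i + 1) * d - A * d * u.denom = P * n * u.denom := by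
    apply hinj
    rw [map_sub, map_mul, map_mul, map_mul, map_mul, map_mul _ (P * n), ← hx, h2]
    ring
  have h4 : P ∣ A * d * u.denom := by
    refine ⟨u.num * P ^ (2 * i) * d - n * u.denom, ?_⟩
    linear_combination - h3
  rcases hPi.prime.dvd_or_dvd h4 with h | h
  · rcases hPi.prime.dvd_or_dvd h with h | h
    · exact hAP h
    · exact hd h
  · exact hD h

lemma U_injective {c c' : Coef Fq} (hc : isX c) (hc' : isX c') {G G' : Polynomial Fq}
    (h : U c + algebraMap (Polynomial Fq) (RatFunc Fq) G =
      U c' + algebraMap (Polynomial Fq) (RatFunc Fq) G') : c = c' ∧ G = G' := by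
  have hchar : CharP (RatFunc Fq) 2 :=
    charP_of_injective_algebraMap (algebraMap Fq (RatFunc Fq)).injective 2
  have h1 : U (c + c') + algebraMap (Polynomial Fq) (RatFunc Fq) (G + G') = 0 := by
    rw [U_add, map_add]
    have : U c + U c' + (algebraMap (Polynomial Fq) (RatFunc Fq) G +
      algebraMap (Polynomial Fq) (RatFunc Fq) G') =
      (U c + algebraMap (Polynomial Fq) (RatFunc Fq) G) +
      (U c' + algebraMap (Polynomial Fq) (RatFunc Fq) G') := by ring
    rw [this, h]
    exact CharTwo.add_self_eq_zero _
  have h2 : c + c' = 0 := by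
    rw [← Finsupp.support_eq_empty]
    by_contra hne
    obtain ⟨j, hj⟩ := Finset.nonempty_iff_ne_empty.2 hne
    have := dvd_denom (hc.add hc') (G + G') (Finset.mem_image_of_mem Sigma.fst hj)
    rw [h1, RatFunc.denom_zero] at this
    exact ((hc.add hc') j hj).2.1.not_isUnit (isUnit_of_dvd_one this)
  have h3 : c = c' := by
    have : c + c' + c' = c' := by rw [h2, zero_add]
    rwa [add_assoc, coef_add_self, add_zero] at this
  subst h3
  exact ⟨rfl, RatFunc.algebraMap_injective Fq (add_left_cancel h)⟩

lemma exists_Rep_term {f P A : Polynomial Fq} {k : ℕ} (hP : P.Monic) (hc : IsCoprime f (P ^ k)) :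
    ∃ h, Rep f (algebraMap (Polynomial Fq) (RatFunc Fq) A /
        algebraMap (Polynomial Fq) (RatFunc Fq) P ^ k) h := by
  obtain ⟨a, b, hab⟩ := id hc
  refine ⟨A * b, A, P ^ k, hc, ?_, ⟨- (A * a), ?_⟩⟩
  · have : algebraMap (Polynomial Fq) (RatFunc Fq) P ≠ 0 := by simpa using hP.ne_zero
    rw [map_pow, div_mul_cancel₀ _ (pow_ne_zero _ this)]
  · linear_combination A * hab

lemma exists_Rep_U {f : Polynomial Fq} {c : Coef Fq} (hc : isX c) (hf : IsCoprime f (cond c)) :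
    ∃ h, Rep f (U c) h := by
  unfold U Finsupp.sum
  apply Finset.sum_induction _ (fun x => ∃ h, Rep f x h)
  · rintro a b ⟨h, hh⟩ ⟨k, hk⟩; exact ⟨_, hh.add hk⟩
  · exact ⟨0, by simpa using Rep.poly f 0⟩
  · intro j hj
    refine exists_Rep_term (hc j hj).1 ?_
    have h1 : j.1 ^ (j.2 + 1) ∣ cond c := (cond_dvd_iff hc _).1 dvd_rfl j hj
    have h2 := hf.of_isCoprime_of_dvd_right ((dvd_pow_self j.1 (Nat.succ_ne_zero _)).trans h1)
    exact h2.pow_right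

lemma isCoprime_denom_iff {f : Polynomial Fq} {c : Coef Fq} (hc : isX c) (G : Polynomial Fq) :
    IsCoprime f (U c + algebraMap (Polynomial Fq) (RatFunc Fq) G).denom ↔ IsCoprime f (cond c) := by
  constructor
  · intro h
    apply IsCoprime.prod_right
    intro P hP
    exact IsCoprime.pow_right (h.of_isCoprime_of_dvd_right (dvd_denom hc G hP))
  · intro h
    obtain ⟨k, hk⟩ := exists_Rep_U hc h
    exact (hk.add (Rep.poly f G)).denom.1

/-- The character value. -/
def chi (c : Coef Fq) (f : Polynomial Fq) : ℤ := quadSym (U c) f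

lemma chi_of_not {f : Polynomial Fq} {c : Coef Fq} (hc : isX c) (h : ¬ IsCoprime f (cond c)) :
    chi c f = 0 := by
  apply quadSym_of_not
  have := isCoprime_denom_iff (f := f) hc 0
  rw [map_zero, add_zero] at this
  rwa [this]

lemma quadSym_add_poly {f : Polynomial Fq} (hf : f.Monic) (hξ : ∃ t : Fq, psi t = -1)
    {c : Coef Fq} (hc : isX c) (G : Polynomial Fq) :
    quadSym (U c + algebraMap (Polynomial Fq) (RatFunc Fq) G) f = chi c f * psi (lam f G) := by
  by_cases h : IsCoprime f (cond c)
  · obtain ⟨k, hk⟩ := exists_Rep_U hc h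
    rw [quadSym_eq hf hξ (hk.add (Rep.poly f G)), chi, quadSym_eq hf hξ hk, lam_add, psi_add]
  · rw [chi_of_not hc h, quadSym_of_not, zero_mul]
    rwa [isCoprime_denom_iff hc]

lemma chi_sq {f : Polynomial Fq} (hf : f.Monic) (hξ : ∃ t : Fq, psi t = -1)
    {c : Coef Fq} (hc : isX c) (hb : sqB f = 0) :
    chi c f = if IsCoprime f (cond c) then 1 else 0 := by
  split_ifs with h
  · obtain ⟨k, hk⟩ := exists_Rep_U hc h
    rw [chi, quadSym_eq hf hξ hk, lam, derivative_eq, hb]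
    simp [res, psi_zero]
  · exact chi_of_not hc h

lemma lam_of_sqB {f : Polynomial Fq} (hb : sqB f = 0) (G : Polynomial Fq) : lam f G = 0 := by
  rw [lam, derivative_eq, hb]; simp [res]

lemma chi_abs_le {f : Polynomial Fq} (hf : f.Monic) (hξ : ∃ t : Fq, psi t = -1)
    {c : Coef Fq} (hc : isX c) : |(chi c f : ℝ)| ≤ if IsCoprime f (cond c) then 1 else 0 := by
  split_ifs with h
  · obtain ⟨k, hk⟩ := exists_Rep_U hc h
    rw [chi, quadSym_eq hf hξ hk]
    rcases psi_eq (lam f k) with h | h <;> rw [h] <;> norm_num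
  · rw [chi_of_not hc h]; simp

lemma chi_add_single {f : Polynomial Fq} (hf : f.Monic) (hξ : ∃ t : Fq, psi t = -1)
    {c : Coef Fq} (hc : isX c) {j : Σ _ : Polynomial Fq, ℕ} {A h : Polynomial Fq}
    (hs : isX (Finsupp.single j A))
    (hr : Rep f (U (Finsupp.single j A)) h) :
    chi (c + Finsupp.single j A) f = chi c f * psi (lam f h) := by
  by_cases h1 : IsCoprime f (cond c)
  · obtain ⟨k, hk⟩ := exists_Rep_U hc h1
    have := hk.add hr
    rw [← U_add] at this
    rw [chi, quadSym_eq hf hξ this, chi, quadSym_eq hf hξ hk, lam_add, psi_add]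
  · rw [chi_of_not hc h1, zero_mul]
    apply chi_of_not (hc.add hs)
    intro h2
    obtain ⟨k, hk⟩ := exists_Rep_U (hc.add hs) h2
    have h3 := (hk.add hr).denom.1
    rw [← U_add, add_assoc, coef_add_self, add_zero] at h3
    have h4 := isCoprime_denom_iff (f := f) hc 0
    rw [map_zero, add_zero] at h4
    exact h1 (h4.1 h3)

lemma dvd_of_pow_dvd {N b : Polynomial Fq} (hN : N.Monic) (hb : b ≠ 0)
    (h : ∀ P : Polynomial Fq, P.Monic → Irreducible P → ∀ i, P ^ (i + 1) ∣ N → P ^ (i + 1) ∣ b) :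
    N ∣ b := by
  rw [dvd_iff_normalizedFactors_le_normalizedFactors hN.ne_zero hb, Multiset.le_iff_count]
  intro P
  rcases Nat.eq_zero_or_pos ((normalizedFactors N).count P) with h0 | h0
  · rw [h0]; exact Nat.zero_le _
  · have hm : P ∈ normalizedFactors N := Multiset.count_pos.1 h0
    have hi := irreducible_of_normalized_factor P hm
    have hmo := nf_monic hm
    have e1 := emultiplicity_eq_count_normalizedFactors hi hN.ne_zero
    have e2 := emultiplicity_eq_count_normalizedFactors hi hb
    rw [hmo.normalize_eq_self] at e1 e2
    have h3 := h P hmo hi ((normalizedFactors N).count P - 1) (by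
      rw [Nat.sub_add_cancel h0, pow_dvd_iff_le_emultiplicity, e1])
    rw [Nat.sub_add_cancel h0, pow_dvd_iff_le_emultiplicity, e2] at h3
    exact_mod_cast h3

/-- Decomposition of `N` relative to `f`. -/
lemma exists_decomp {f : Polynomial Fq} (hf : f.Monic) (n : ℕ) : ∀ N : Polynomial Fq, N.Monic →
    N.natDegree = n → ∃ D s t : Polynomial Fq, D.Monic ∧ s.Monic ∧ t.Monic ∧ N = D * s * t ^ 2 ∧
      Squarefree s ∧ s ∣ f ∧ IsCoprime f D ∧ ∀ E, E ∣ N → IsCoprime f E → E ∣ D := by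
  induction n using Nat.strong_induction_on with
  | _ n ih =>
  intro N hN hn
  by_cases hc : IsCoprime f N
  · exact ⟨N, 1, 1, hN, monic_one, monic_one, by ring, squarefree_one, one_dvd _, hc,
      fun E hE _ => hE⟩
  · have : ∃ P : Polynomial Fq, P.Monic ∧ Irreducible P ∧ P ∣ f ∧ P ∣ N := by
      by_contra hno
      push Not at hno
      apply hc
      apply isCoprime_of_prime_dvd
      · rintro ⟨h, -⟩; exact hf.ne_zero h
      · intro P hP h1 h2
        refine hno (normalize P) (monic_normalize hP.ne_zero) ?_ ?_ ?_
        · exact (associated_normalize P).irreducible hP.irreducible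
        · exact normalize_dvd_iff.2 h1
        · exact normalize_dvd_iff.2 h2
    obtain ⟨P, hPm, hPi, hPf, N1, rfl⟩ := this
    have hN1 : N1.Monic := hPm.of_mul_monic_left hN
    rw [hPm.natDegree_mul hN1] at hn
    have := hPi.natDegree_pos
    obtain ⟨D, s, t, hD, hs, ht, he, hsq, hsf, hDf, hmax⟩ := ih N1.natDegree (by omega) N1 hN1 rfl
    have hmax' : ∀ E, E ∣ P * N1 → IsCoprime f E → E ∣ D := by
      intro E hE hcE
      refine hmax E (IsCoprime.dvd_of_dvd_mul_left ?_ hE) hcE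
      exact (hcE.of_isCoprime_of_dvd_left hPf).symm
    by_cases hPs : P ∣ s
    · obtain ⟨s', rfl⟩ := hPs
      refine ⟨D, s', P * t, hD, hPm.of_mul_monic_left hs, hPm.mul ht, by rw [he]; ring,
        hsq.of_mul_right, (dvd_mul_left _ _).trans hsf, hDf, hmax'⟩
    · have hcop : IsCoprime P s := (Irreducible.coprime_iff_not_dvd hPi).2 hPs
      refine ⟨D, P * s, t, hD, hPm.mul hs, ht, by rw [he]; ring, ?_, hcop.mul_dvd hPf hsf, hDf,
        hmax'⟩
      exact (squarefree_mul_iff).2 ⟨hcop.isRelPrime, hPi.squarefree, hsq⟩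

/-- The basic character sum bound. -/
lemma char_sum_bound {f : Polynomial Fq} (hf : f.Monic) (hξ : ∃ t : Fq, psi t = -1)
    (hb : sqB f ≠ 0) {N D : Polynomial Fq} (hN : N.Monic) (hD : D.Monic) (hDN : D ∣ N)
    (hDf : IsCoprime f D) (hmax : ∀ E, E ∣ N → IsCoprime f E → E ∣ D) :
    |∑ c ∈ XN N, (chi c f : ℝ)| ≤ if D ∣ sqB f then (Fintype.card Fq : ℝ) ^ D.natDegree else 0 := by
  split_ifs with hDb
  · calc |∑ c ∈ XN N, (chi c f : ℝ)| ≤ ∑ c ∈ XN N, |(chi c f : ℝ)| := Finset.abs_sum_le_sum_abs _ _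
      _ ≤ ∑ c ∈ XN N, if IsCoprime f (cond c) then (1 : ℝ) else 0 :=
          Finset.sum_le_sum fun c hc => chi_abs_le hf hξ ((mem_XN' hN).1 hc).1
      _ = (((XN N).filter (fun c => IsCoprime f (cond c))).card : ℝ) := by
          rw [Finset.sum_boole]
      _ ≤ ((XN D).card : ℝ) := by
          norm_cast
          apply Finset.card_le_card
          intro c hc
          rw [Finset.mem_filter, mem_XN' hN] at hc
          rw [mem_XN' hD]
          exact ⟨hc.1.1, hmax _ hc.1.2 hc.2⟩
      _ = _ := by rw [card_XN hD]; push_cast; rfl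
  · have : ∃ P : Polynomial Fq, P.Monic ∧ Irreducible P ∧ ∃ i, P ^ (i + 1) ∣ D ∧
        P ^ i ∣ sqB f ∧ ¬ P ^ (i + 1) ∣ sqB f := by
      by_contra hno
      push Not at hno
      apply hDb
      apply dvd_of_pow_dvd hD hb
      intro P hP hPi i
      induction i with
      | zero => intro h; exact hno P hP hPi 0 h (by simp)
      | succ i ih =>
        intro h
        exact hno P hP hPi (i + 1) h (ih ((pow_dvd_pow P (by omega)).trans h))
    obtain ⟨P, hPm, hPi, i, hPD, h1, h2⟩ := this
    have hfP : IsCoprime f P := hDf.of_isCoprime_of_dvd_right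
      ((dvd_pow_self P (Nat.succ_ne_zero i)).trans hPD)
    obtain ⟨t, ht⟩ := id hξ
    obtain ⟨A, h, hAd, hrep, hl⟩ := exists_detect hf hPm hPi hfP i h1 h2 t
    set d : Coef Fq := Finsupp.single ⟨P, i⟩ A with hd
    have hdX : isX d := by
      intro j hj
      have := Finset.mem_singleton.1 (Finsupp.support_single_subset hj)
      subst this
      refine ⟨hPm, hPi, ?_⟩
      rw [hd, Finsupp.single_eq_same]; exact hAd
    have hdN : d ∈ XN N := by
      rw [mem_XN hN]
      refine ⟨hdX, fun j hj => ?_⟩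
      have := Finset.mem_singleton.1 (Finsupp.support_single_subset hj)
      subst this
      exact hPD.trans hDN
    have hrep' : Rep f (U d) h := by rw [hd, U_single]; exact hrep
    have hsum : ∑ c ∈ XN N, (chi c f : ℝ) = ∑ c ∈ XN N, (chi (c + d) f : ℝ) := by
      symm
      refine Finset.sum_nbij' (fun c => c + d) (fun c => c + d) ?_ ?_ ?_ ?_ ?_
      · intro c hc; exact XN_add hN hc hdN
      · intro c hc; exact XN_add hN hc hdN
      · intro c _; show c + d + d = c; rw [add_assoc, coef_add_self, add_zero]
      · intro c _; show c + d + d = c; rw [add_assoc, coef_add_self, add_zero]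
      · intro c _; rfl
    have hneg : ∑ c ∈ XN N, (chi (c + d) f : ℝ) = - ∑ c ∈ XN N, (chi c f : ℝ) := by
      rw [← Finset.sum_neg_distrib]
      refine Finset.sum_congr rfl fun c hc => ?_
      rw [chi_add_single hf hξ ((mem_XN' hN).1 hc).1 hdX hrep', hl, ht]
      push_cast; ring
    have : ∑ c ∈ XN N, (chi c f : ℝ) = 0 := by linarith
    rw [this]; simp

end USec
end EvenChar

namespace EvenChar
open scoped Classical
set_option linter.unusedSectionVars false

section Bound
variable {Fq : Type} [Field Fq] [Fintype Fq] [CharP Fq 2]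

lemma card_pos' : (0 : ℝ) < (Fintype.card Fq : ℝ) := by exact_mod_cast Fintype.card_pos

lemma two_le_card : (2 : ℝ) ≤ (Fintype.card Fq : ℝ) := by
  exact_mod_cast (Fintype.one_lt_card : 1 < Fintype.card Fq)

lemma card_multiples {D : Polynomial Fq} {d : ℕ} (hD : D ∈ Mon Fq d) (n : ℕ) :
    (((polysLT Fq n).filter (fun b => D ∣ b ∧ b ≠ 0)).card : ℝ) ≤
      (Fintype.card Fq : ℝ) ^ n / (Fintype.card Fq : ℝ) ^ d := by
  rw [mem_Mon] at hD
  have hq := card_pos' (Fq := Fq)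
  by_cases h : d ≤ n
  · have h1 : ((polysLT Fq n).filter (fun b => D ∣ b ∧ b ≠ 0)) ⊆
        (polysLT Fq (n - d)).image (D * ·) := by
      intro b hb
      rw [Finset.mem_filter, mem_polysLT] at hb
      obtain ⟨hb1, ⟨c, rfl⟩, hb3⟩ := hb
      refine Finset.mem_image.2 ⟨c, ?_, rfl⟩
      have hc : c ≠ 0 := right_ne_zero_of_mul hb3
      rw [← natDegree_lt_iff_degree_lt hb3, natDegree_mul hD.1.ne_zero hc, hD.2] at hb1
      rw [mem_polysLT, ← natDegree_lt_iff_degree_lt hc]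
      omega
    have h2 := (Finset.card_le_card h1).trans Finset.card_image_le
    rw [card_polysLT] at h2
    rw [le_div_iff₀ (pow_pos hq _)]
    calc _ ≤ ((Fintype.card Fq ^ (n - d) : ℕ) : ℝ) * (Fintype.card Fq : ℝ) ^ d := by
          gcongr
      _ = _ := by push_cast; rw [← pow_add]; congr 1; omega
  · have : ((polysLT Fq n).filter (fun b => D ∣ b ∧ b ≠ 0)) = ∅ := by
      rw [Finset.filter_eq_empty_iff]
      rintro b hb ⟨h1, h2⟩
      rw [mem_polysLT, ← natDegree_lt_iff_degree_lt h2] at hb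
      have := natDegree_le_of_dvd h1 h2
      omega
    rw [this]; simp; positivity

lemma card_sqA {s : Polynomial Fq} {e : ℕ} (hs : s ∈ Mon Fq e) (hsq : Squarefree s)
    (n : ℕ) (b : Polynomial Fq) :
    (((polysLT Fq n).filter (fun a => s ∣ a ^ 2 + X * b ^ 2)).card : ℝ) ≤
      (Fintype.card Fq : ℝ) ^ n / (Fintype.card Fq : ℝ) ^ e + 1 := by
  have hq := card_pos' (Fq := Fq)
  rcases ((polysLT Fq n).filter (fun a => s ∣ a ^ 2 + X * b ^ 2)).eq_empty_or_nonempty with h | h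
  · rw [h]; simp; positivity
  · obtain ⟨a0, ha0⟩ := h
    rw [Finset.mem_filter, mem_polysLT] at ha0
    have h1 : ((polysLT Fq n).filter (fun a => s ∣ a ^ 2 + X * b ^ 2)) ⊆
        ((insert 0 ((polysLT Fq n).filter (fun b => s ∣ b ∧ b ≠ 0))).image (· + a0)) := by
      intro a ha
      rw [Finset.mem_filter, mem_polysLT] at ha
      refine Finset.mem_image.2 ⟨a - a0, ?_, by ring⟩
      rw [Finset.mem_insert, Finset.mem_filter, mem_polysLT]
      by_cases h0 : a - a0 = 0
      · exact Or.inl h0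
      · refine Or.inr ⟨(degree_sub_le _ _).trans_lt (max_lt ha.1 ha0.1), ?_, h0⟩
        apply hsq.isRadical 2
        have : (a - a0) ^ 2 = (a ^ 2 + X * b ^ 2) - (a0 ^ 2 + X * b ^ 2) := by
          rw [sub_pow_char]; ring
        rw [this]
        exact dvd_sub ha.2 ha0.2
    have h2 := (Finset.card_le_card h1).trans
      (Finset.card_image_le.trans (Finset.card_insert_le _ _))
    have h3 := card_multiples hs n
    have h4 : (((polysLT Fq n).filter (fun a => s ∣ a ^ 2 + X * b ^ 2)).card : ℝ) ≤
      (((polysLT Fq n).filter (fun b => s ∣ b ∧ b ≠ 0)).card : ℝ) + 1 := by exact_mod_cast h2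
    linarith

lemma card_pairs {D s : Polynomial Fq} {d e : ℕ} (hD : D ∈ Mon Fq d) (hs : s ∈ Mon Fq e)
    (hsq : Squarefree s) (m s0 : ℕ) :
    (((Mon Fq m).filter (fun f => (sqB f ≠ 0 ∧ (sqB f).natDegree + s0 ≤ m / 2) ∧
      (D ∣ sqB f ∧ s ∣ f))).card : ℝ) ≤
    (Fintype.card Fq : ℝ) ^ (m / 2 + 1) / (Fintype.card Fq : ℝ) ^ s0 / (Fintype.card Fq : ℝ) ^ d *
      ((Fintype.card Fq : ℝ) ^ (m / 2 + 1) / (Fintype.card Fq : ℝ) ^ e + 1) := by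
  have hq := card_pos' (Fq := Fq)
  by_cases hK : s0 ≤ m / 2
  · set B := (polysLT Fq (m / 2 + 1 - s0)).filter (fun b => D ∣ b ∧ b ≠ 0) with hB
    set T := B.sigma (fun b => (polysLT Fq (m / 2 + 1)).filter (fun a => s ∣ a ^ 2 + X * b ^ 2))
      with hT
    have h1 : ((Mon Fq m).filter (fun f => (sqB f ≠ 0 ∧ (sqB f).natDegree + s0 ≤ m / 2) ∧
      (D ∣ sqB f ∧ s ∣ f))).card ≤ T.card := by
      apply Finset.card_le_card_of_injOn
        (fun f => (⟨sqB f, sqA f⟩ : Σ _ : Polynomial Fq, Polynomial Fq))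
      · intro f hf
        rw [Finset.mem_coe, Finset.mem_filter, mem_Mon] at hf
        obtain ⟨⟨hf1, hf2⟩, ⟨hf3, hf4⟩, hf5, hf6⟩ := hf
        rw [Finset.mem_coe, hT, Finset.mem_sigma, hB, Finset.mem_filter, Finset.mem_filter,
          mem_polysLT, mem_polysLT_succ, ← natDegree_lt_iff_degree_lt hf3]
        refine ⟨⟨by show (sqB f).natDegree < _; omega, hf5, hf3⟩, ?_, ?_⟩
        · have := two_mul_natDegree_sqA f
          show (sqA f).natDegree ≤ _
          omega
        · show s ∣ sqA f ^ 2 + X * sqB f ^ 2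
          rw [← sq_decomp]; exact hf6
      · intro f _ g _ h
        simp only [Sigma.mk.injEq, heq_eq_eq] at h
        rw [sq_decomp f, sq_decomp g, h.1, h.2]
    have h2 : (T.card : ℝ) ≤ B.card * ((Fintype.card Fq : ℝ) ^ (m / 2 + 1) /
        (Fintype.card Fq : ℝ) ^ e + 1) := by
      rw [hT, Finset.card_sigma]
      push_cast
      rw [← nsmul_eq_mul]
      exact Finset.sum_le_card_nsmul _ _ _ (fun b _ => card_sqA hs hsq _ b)
    have h3 := card_multiples hD (m / 2 + 1 - s0)
    have h4 : (Fintype.card Fq : ℝ) ^ (m / 2 + 1 - s0) =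
        (Fintype.card Fq : ℝ) ^ (m / 2 + 1) / (Fintype.card Fq : ℝ) ^ s0 := by
      rw [pow_sub₀ _ hq.ne' (by omega)]; rfl
    rw [h4] at h3
    calc _ ≤ (T.card : ℝ) := by exact_mod_cast h1
      _ ≤ _ := h2
      _ ≤ _ := by gcongr
  · have : ((Mon Fq m).filter (fun f => (sqB f ≠ 0 ∧ (sqB f).natDegree + s0 ≤ m / 2) ∧
      (D ∣ sqB f ∧ s ∣ f))) = ∅ := by
      rw [Finset.filter_eq_empty_iff]
      rintro f _ ⟨⟨_, h⟩, _⟩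
      omega
    rw [this]; simp; positivity

/-- Sum of absolute values of character sums. -/
def Wsum (r : ℕ) (f : Polynomial Fq) : ℝ := ∑ N ∈ Mon Fq r, |∑ c ∈ XN N, (chi c f : ℝ)|

/-- weight -/
def wt (f D s : Polynomial Fq) : ℝ :=
  if D ∣ sqB f ∧ s ∣ f then (if Squarefree s then (Fintype.card Fq : ℝ) ^ D.natDegree else 0) else 0

lemma wt_nonneg (f D s : Polynomial Fq) : 0 ≤ wt f D s := by
  unfold wt; split_ifs <;> positivity

/-- Degrees of triples. -/
def Eset (r : ℕ) : Finset (ℕ × ℕ) :=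
  (Finset.range (r + 1) ×ˢ Finset.range (r + 1)).filter (fun p => p.1 + 2 * p.2 ≤ r)

lemma Wsum_le {f : Polynomial Fq} (hf : f.Monic) (hξ : ∃ t : Fq, psi t = -1)
    (hb : sqB f ≠ 0) (r : ℕ) :
    Wsum r f ≤ ∑ p ∈ Eset r, ∑ τ ∈ Mon Fq (r - p.1 - 2 * p.2) ×ˢ (Mon Fq p.1 ×ˢ Mon Fq p.2),
      wt f τ.1 τ.2.1 := by
  have hex : ∀ N : Polynomial Fq, ∃ τ : Polynomial Fq × Polynomial Fq × Polynomial Fq,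
      N ∈ Mon Fq r → (τ.1.Monic ∧ τ.2.1.Monic ∧ τ.2.2.Monic ∧ N = τ.1 * τ.2.1 * τ.2.2 ^ 2 ∧
      |∑ c ∈ XN N, (chi c f : ℝ)| ≤ wt f τ.1 τ.2.1) := by
    intro N
    by_cases hN : N ∈ Mon Fq r
    · have hN' := mem_Mon.1 hN
      obtain ⟨D, s, t, hD, hs, ht, he, hsq, hsf, hDf, hmax⟩ :=
        exists_decomp hf N.natDegree N hN'.1 rfl
      refine ⟨(D, s, t), fun _ => ⟨hD, hs, ht, he, ?_⟩⟩
      have := char_sum_bound hf hξ hb hN'.1 hD ⟨s * t ^ 2, by rw [he]; ring⟩ hDf hmax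
      simpa [wt, hsf, hsq] using this
    · exact ⟨(0, 0, 0), fun h => absurd h hN⟩
  choose τ hτ using hex
  rw [Finset.sum_sigma' (Eset r)
    (fun p => Mon Fq (r - p.1 - 2 * p.2) ×ˢ (Mon Fq p.1 ×ˢ Mon Fq p.2))
    (fun _ τ => wt f τ.1 τ.2.1)]
  set φ : Polynomial Fq → (Σ _ : ℕ × ℕ, Polynomial Fq × Polynomial Fq × Polynomial Fq) :=
    fun N => ⟨((τ N).2.1.natDegree, (τ N).2.2.natDegree), τ N⟩ with hφ
  have hinj : Set.InjOn φ (Mon Fq r : Set (Polynomial Fq)) := by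
    intro N hN M hM h
    have h2 : τ N = τ M := by
      simp only [hφ, Sigma.mk.injEq, heq_eq_eq] at h
      exact h.2
    rw [(hτ N hN).2.2.2.1, (hτ M hM).2.2.2.1, h2]
  calc Wsum r f ≤ ∑ N ∈ Mon Fq r, wt f (φ N).2.1 (φ N).2.2.1 :=
        Finset.sum_le_sum fun N hN => (hτ N hN).2.2.2.2
    _ = ∑ x ∈ (Mon Fq r).image φ, wt f x.2.1 x.2.2.1 := by
        rw [Finset.sum_image hinj]
    _ ≤ _ := by
        apply Finset.sum_le_sum_of_subset_of_nonneg
        · intro x hx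
          obtain ⟨N, hN, rfl⟩ := Finset.mem_image.1 hx
          obtain ⟨h1, h2, h3, h4, -⟩ := hτ N hN
          have h5 := (mem_Mon.1 hN).2
          rw [h4, (h1.mul h2).natDegree_mul (h3.pow 2), h1.natDegree_mul h2, h3.natDegree_pow] at h5
          simp only [hφ, Finset.mem_sigma, Eset, Finset.mem_filter, Finset.mem_product,
            Finset.mem_range, mem_Mon]
          refine ⟨⟨⟨?_, ?_⟩, ?_⟩, ⟨h1, ?_⟩, ⟨h2, trivial⟩, h3, trivial⟩ <;> omega
        · intro x _ _; exact wt_nonneg _ _ _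

lemma geom_le (r : ℕ) : ∑ i ∈ Finset.range (r + 1), ((1 : ℝ) / 2) ^ i ≤ 2 := by
  exact sum_geometric_two_le _

lemma sum_Wsum_le (hξ : ∃ t : Fq, psi t = -1) (m s0 r : ℕ) :
    ∑ f ∈ (Mon Fq m).filter (fun f => sqB f ≠ 0 ∧ (sqB f).natDegree + s0 ≤ m / 2), Wsum r f ≤
    (Fintype.card Fq : ℝ) ^ (m / 2 + 1) / (Fintype.card Fq : ℝ) ^ s0 * (Fintype.card Fq : ℝ) ^ r *
      (4 * (Fintype.card Fq : ℝ) ^ (m / 2 + 1) + 2 * (r + 1)) := by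
  set Q : ℝ := (Fintype.card Fq : ℝ) with hQ
  have hq : 0 < Q := card_pos'
  have hq2 : 2 ≤ Q := two_le_card
  set Y := Q ^ (m / 2 + 1) with hY
  set Z := Y / Q ^ s0 with hZ
  have hY0 : 0 < Y := pow_pos hq _
  have hZ0 : 0 < Z := div_pos hY0 (pow_pos hq _)
  calc _ ≤ ∑ f ∈ (Mon Fq m).filter (fun f => sqB f ≠ 0 ∧ (sqB f).natDegree + s0 ≤ m / 2),
        ∑ p ∈ Eset r, ∑ τ ∈ Mon Fq (r - p.1 - 2 * p.2) ×ˢ (Mon Fq p.1 ×ˢ Mon Fq p.2),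
        wt f τ.1 τ.2.1 := by
        refine Finset.sum_le_sum fun f hf => ?_
        rw [Finset.mem_filter, mem_Mon] at hf
        exact Wsum_le hf.1.1 hξ hf.2.1 r
    _ = ∑ p ∈ Eset r, ∑ τ ∈ Mon Fq (r - p.1 - 2 * p.2) ×ˢ (Mon Fq p.1 ×ˢ Mon Fq p.2),
        ∑ f ∈ (Mon Fq m).filter (fun f => sqB f ≠ 0 ∧ (sqB f).natDegree + s0 ≤ m / 2),
        wt f τ.1 τ.2.1 := by
        rw [Finset.sum_comm]
        refine Finset.sum_congr rfl fun p _ => ?_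
        rw [Finset.sum_comm]
    _ ≤ ∑ p ∈ Eset r, ∑ τ ∈ Mon Fq (r - p.1 - 2 * p.2) ×ˢ (Mon Fq p.1 ×ˢ Mon Fq p.2),
        Z * (Y / Q ^ p.1 + 1) := by
        refine Finset.sum_le_sum fun p _ => Finset.sum_le_sum fun τ hτ => ?_
        rw [Finset.mem_product, Finset.mem_product] at hτ
        by_cases hsq : Squarefree τ.2.1
        · simp only [wt, if_pos hsq]
          rw [← Finset.sum_filter, Finset.filter_filter, Finset.sum_const, nsmul_eq_mul]
          have := card_pairs hτ.1 hτ.2.1 hsq m s0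
          rw [(mem_Mon.1 hτ.1).2, ← hQ]
          rw [← hQ, ← hY, ← hZ] at this
          calc _ ≤ _ := mul_le_mul_of_nonneg_right this (by positivity)
            _ = _ := by field_simp
        · simp only [wt, if_neg hsq, ite_self, Finset.sum_const_zero]
          positivity
    _ = ∑ p ∈ Eset r, Q ^ (r - p.2) * (Z * (Y / Q ^ p.1 + 1)) := by
        refine Finset.sum_congr rfl fun p hp => ?_
        rw [Finset.sum_const, Finset.card_product, Finset.card_product, card_Mon, card_Mon,
          card_Mon, ← pow_add, ← pow_add, nsmul_eq_mul]
        rw [Eset, Finset.mem_filter] at hp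
        push_cast
        congr 2
        omega
    _ ≤ ∑ p ∈ Eset r, Z * Q ^ r * (Y * ((1 / 2) ^ p.1 * (1 / 2) ^ p.2) + (1 / 2) ^ p.2) := by
        refine Finset.sum_le_sum fun p hp => ?_
        rw [Eset, Finset.mem_filter] at hp
        have h1 : Q ^ (r - p.2) = Q ^ r * (1 / Q) ^ p.2 := by
          rw [pow_sub₀ _ hq.ne' (by omega)]; simp
        have h2 : Y / Q ^ p.1 = Y * (1 / Q) ^ p.1 := by simp [div_eq_mul_inv]
        have h3 : 1 / Q ≤ 1 / 2 := by gcongr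
        have h4 : ∀ k, (1 / Q) ^ k ≤ (1 / 2 : ℝ) ^ k := fun k => by gcongr
        rw [h1, h2]
        have e : Q ^ r * (1 / Q) ^ p.2 * (Z * (Y * (1 / Q) ^ p.1 + 1)) =
          Z * Q ^ r * (Y * ((1 / Q) ^ p.1 * (1 / Q) ^ p.2) + (1 / Q) ^ p.2) := by ring
        rw [e]
        gcongr
    _ ≤ ∑ p ∈ Finset.range (r + 1) ×ˢ Finset.range (r + 1),
          Z * Q ^ r * (Y * ((1 / 2) ^ p.1 * (1 / 2) ^ p.2) + (1 / 2) ^ p.2) := by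
        apply Finset.sum_le_sum_of_subset_of_nonneg (Finset.filter_subset _ _)
        intro p _ _; positivity
    _ = Z * Q ^ r * (Y * ((∑ i ∈ Finset.range (r + 1), ((1 : ℝ) / 2) ^ i) *
          ∑ i ∈ Finset.range (r + 1), ((1 : ℝ) / 2) ^ i) +
          (r + 1) * ∑ i ∈ Finset.range (r + 1), ((1 : ℝ) / 2) ^ i) := by
        rw [← Finset.mul_sum, Finset.sum_add_distrib, ← Finset.mul_sum, Finset.sum_mul_sum,
          Finset.sum_product, Finset.sum_product]
        simp
    _ ≤ Z * Q ^ r * (Y * (2 * 2) + (r + 1) * 2) := by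
        have := geom_le r
        gcongr
    _ = _ := by ring

/-- Character sum over conductors of degree `r`. -/
def Tsum (r : ℕ) (f : Polynomial Fq) : ℝ := ∑ c ∈ Cset Fq r, (chi c f : ℝ)

lemma Tsum_zero_le (f : Polynomial Fq) : |Tsum 0 f| ≤ Wsum 0 f := by
  rw [Tsum, sum_Cset_zero]
  exact Finset.abs_sum_le_sum_abs _ _

lemma Tsum_succ_le (r : ℕ) (f : Polynomial Fq) :
    |Tsum (r + 1) f| ≤ Wsum (r + 1) f + (Fintype.card Fq : ℝ) * Wsum r f := by
  rw [Tsum, sum_Cset_succ]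
  refine (abs_sub _ _).trans ?_
  rw [abs_mul, abs_of_pos card_pos']
  exact add_le_add (Finset.abs_sum_le_sum_abs _ _)
    (mul_le_mul_of_nonneg_left (Finset.abs_sum_le_sum_abs _ _) card_pos'.le)

lemma sum_Tsum_le (hξ : ∃ t : Fq, psi t = -1) (m s0 r : ℕ) :
    ∑ f ∈ (Mon Fq m).filter (fun f => sqB f ≠ 0 ∧ (sqB f).natDegree + s0 ≤ m / 2), |Tsum r f| ≤
    2 * ((Fintype.card Fq : ℝ) ^ (m / 2 + 1) / (Fintype.card Fq : ℝ) ^ s0 *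
      (Fintype.card Fq : ℝ) ^ r *
      (4 * (Fintype.card Fq : ℝ) ^ (m / 2 + 1) + 2 * (r + 1))) := by
  have hq : (0 : ℝ) < (Fintype.card Fq : ℝ) := card_pos'
  cases r with
  | zero =>
    refine (Finset.sum_le_sum fun f _ => Tsum_zero_le f).trans ((sum_Wsum_le hξ m s0 0).trans ?_)
    refine le_mul_of_one_le_left ?_ (by norm_num)
    positivity
  | succ r =>
    refine (Finset.sum_le_sum fun f _ => Tsum_succ_le r f).trans ?_
    rw [Finset.sum_add_distrib, ← Finset.mul_sum, two_mul]
    refine add_le_add (sum_Wsum_le hξ m s0 (r + 1)) ?_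
    refine (mul_le_mul_of_nonneg_left (sum_Wsum_le hξ m s0 r) hq.le).trans ?_
    rw [pow_succ (Fintype.card Fq : ℝ) r]
    push_cast
    set Q : ℝ := (Fintype.card Fq : ℝ)
    calc _ = Q ^ (m / 2 + 1) / Q ^ s0 * (Q ^ r * Q) * (4 * Q ^ (m / 2 + 1) + 2 * (r + 1)) := by ring
      _ ≤ _ := by
        gcongr
        linarith

end Bound
end EvenChar

namespace EvenChar
open scoped Classical
set_option linter.unusedSectionVars false

section Family
variable {Fq : Type} [Field Fq] [Fintype Fq] [CharP Fq 2]

/-- Abstract conditions on a family of polynomial parts. -/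
structure GFam (𝒢 : ℕ → Finset (Polynomial Fq)) : Prop where
  card_le : ∀ s, ((𝒢 s).card : ℝ) ≤ 2 * (Fintype.card Fq : ℝ) ^ s
  nonempty : ∃ s, (𝒢 s).Nonempty
  orth : ∀ s f, f.Monic → sqB f ≠ 0 → ¬ ((sqB f).natDegree + s ≤ f.natDegree / 2) →
    ∑ G ∈ 𝒢 s, (psi (lam f G) : ℝ) = 0

/-- The family concentrated at one polynomial. -/
def G0 (E : Polynomial Fq) (s : ℕ) : Finset (Polynomial Fq) := if s = 0 then {E} else ∅

lemma GFam_G0 (E : Polynomial Fq) : GFam (G0 E) := by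
  refine ⟨fun s => ?_, ⟨0, by simp [G0]⟩, fun s f hf hb h => ?_⟩
  · unfold G0
    split_ifs with h
    · subst h; simp
    · simp
  · unfold G0
    split_ifs with h0
    · have := two_mul_natDegree_sqB f hb
      omega
    · simp

lemma sum_psi_eq_zero {𝒮 : Finset (Polynomial Fq)} {f E : Polynomial Fq}
    (h : ∀ G ∈ 𝒮, G + E ∈ 𝒮) (hE : psi (lam f E) = -1) : ∑ G ∈ 𝒮, (psi (lam f G) : ℝ) = 0 := by
  have hEE : ∀ G : Polynomial Fq, G + E + E = G := fun G => by
    rw [add_assoc, CharTwo.add_self_eq_zero, add_zero]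
  have h1 : ∑ G ∈ 𝒮, (psi (lam f G) : ℝ) = ∑ G ∈ 𝒮, (psi (lam f (G + E)) : ℝ) := by
    symm
    refine Finset.sum_nbij' (fun G => G + E) (fun G => G + E) h h ?_ ?_ ?_
    · intro G _; exact hEE G
    · intro G _; exact hEE G
    · intro G _; rfl
  have h2 : ∑ G ∈ 𝒮, (psi (lam f (G + E)) : ℝ) = - ∑ G ∈ 𝒮, (psi (lam f G) : ℝ) := by
    rw [← Finset.sum_neg_distrib]
    refine Finset.sum_congr rfl fun G _ => ?_
    rw [lam_add, psi_add, hE]; push_cast; ring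
  linarith

/-- Finset version of `G_s`. -/
def Gset (ξ : Fq) (s : ℕ) : Finset (Polynomial Fq) :=
  (({0, ξ} : Finset Fq) ×ˢ (Finset.univ : Finset (Fin s → Fq))).image (fun p =>
    C p.1 + ∑ i : Fin s, C (p.2 i) * X ^ (2 * ((i : ℕ) + 1) - 1)) |>.filter (· ∈ Gfam ξ s)

lemma mem_Gset {ξ : Fq} {s : ℕ} {G : Polynomial Fq} : G ∈ Gset ξ s ↔ G ∈ Gfam ξ s := by
  unfold Gset
  rw [Finset.mem_filter]
  refine ⟨fun h => h.2, fun h => ⟨?_, h⟩⟩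
  obtain ⟨α, c, hα, hc, rfl⟩ := h
  refine Finset.mem_image.2 ⟨(α, fun i => c ((i : ℕ) + 1)), ?_, ?_⟩
  · simpa using hα
  · congr 1
    rw [Fin.sum_univ_eq_sum_range (fun i => C (c (i + 1)) * (X : Polynomial Fq) ^ (2 * (i + 1) - 1)),
      Finset.range_eq_Ico, Finset.sum_Ico_add' (fun i => C (c i) * (X : Polynomial Fq) ^ (2 * i - 1))]
    rfl

/-- The family for the ramified imaginary case. -/
def GI (ξ : Fq) (s : ℕ) : Finset (Polynomial Fq) := if s = 0 then ∅ else Gset ξ s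

lemma GFam_GI (ξ : Fq) (hξ : psi ξ = -1) : GFam (GI ξ) := by
  refine ⟨fun s => ?_, ⟨1, ?_⟩, fun s f hf hb h => ?_⟩
  · unfold GI
    split_ifs with h
    · subst h; simp
    · have h1 : (Gset ξ s).card ≤ 2 * Fintype.card Fq ^ s := by
        unfold Gset
        refine (Finset.card_filter_le _ _).trans (Finset.card_image_le.trans ?_)
        rw [Finset.card_product]
        refine Nat.mul_le_mul Finset.card_le_two ?_
        simp
      exact_mod_cast h1
  · refine ⟨C 0 + ∑ i ∈ Finset.Icc 1 1, C 1 * X ^ (2 * i - 1), ?_⟩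
    simp only [GI, one_ne_zero, if_false]
    rw [mem_Gset]
    exact ⟨0, fun _ => 1, Or.inl rfl, one_ne_zero, rfl⟩
  · unfold GI
    split_ifs with h0
    · simp
    · rcases Nat.even_or_odd' f.natDegree with ⟨k, hk | hk⟩
      · have h1 := two_mul_natDegree_sqB f hb
        obtain ⟨c', hc'⟩ := exists_detect_inf hf hb k (k - (sqB f).natDegree) hk (by omega)
          (by omega) ξ
        apply sum_psi_eq_zero (E := C c' * X ^ (2 * (k - (sqB f).natDegree) - 1)) _ (by rw [hc', hξ])
        intro G hG
        rw [mem_Gset] at hG ⊢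
        obtain ⟨α, c, hα, hc, rfl⟩ := hG
        set t := k - (sqB f).natDegree with ht
        refine ⟨α, fun i => c i + if i = t then c' else 0, hα, ?_, ?_⟩
        · show c s + (if s = t then c' else 0) ≠ 0
          rw [if_neg (by omega), add_zero]; exact hc
        · simp only [map_add, add_mul, Finset.sum_add_distrib]
          rw [add_assoc]
          congr 2
          rw [Finset.sum_eq_single t]
          · simp
          · intro b _ hb; simp [hb]
          · intro hn; exact absurd (Finset.mem_Icc.2 (by omega)) hn
      · apply sum_psi_eq_zero (E := C ξ)
        · intro G hG
          rw [mem_Gset] at hG ⊢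
          obtain ⟨α, c, hα, hc, rfl⟩ := hG
          refine ⟨α + ξ, c, ?_, hc, ?_⟩
          · rcases hα with rfl | rfl
            · right; simp
            · left; exact CharTwo.add_self_eq_zero _
          · rw [map_add]; ring
        · rw [lam_C hf, hk]
          push_cast
          rw [CharTwo.two_eq_zero, zero_mul, zero_add, mul_one, hξ]

/-- `q^{-1/2}`. -/
def yy (Fq : Type) [Fintype Fq] : ℝ := (Real.sqrt (Fintype.card Fq : ℝ))⁻¹

lemma yy_pos : 0 < yy Fq := inv_pos.2 (Real.sqrt_pos.2 card_pos')

lemma yy_sq : yy Fq ^ 2 = (Fintype.card Fq : ℝ)⁻¹ := by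
  rw [yy, inv_pow, Real.sq_sqrt card_pos'.le]

lemma yy_pow_even (l : ℕ) : yy Fq ^ (2 * l) = ((Fintype.card Fq : ℝ) ^ l)⁻¹ := by
  rw [pow_mul, yy_sq, inv_pow]

lemma yy_le_one : yy Fq ≤ 1 := by
  have h := yy_sq (Fq := Fq)
  have h1 : yy Fq ^ 2 ≤ 1 := by
    rw [h]
    exact inv_le_one_of_one_le₀ (by linarith [two_le_card (Fq := Fq)])
  have := yy_pos (Fq := Fq)
  nlinarith

lemma yy_pow_le (m : ℕ) : yy Fq ^ m ≤ ((Fintype.card Fq : ℝ) ^ (m / 2))⁻¹ := by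
  rw [← yy_pow_even]
  exact pow_le_pow_of_le_one yy_pos.le yy_le_one (by omega)

/-- The total sum. -/
def totalS (𝒢 : ℕ → Finset (Polynomial Fq)) (n M : ℕ) : ℝ :=
  ∑ p ∈ Finset.HasAntidiagonal.antidiagonal n, ∑ c ∈ Cset Fq p.1, ∑ G ∈ 𝒢 p.2,
    ∑ m ∈ Finset.range (M + 1), yy Fq ^ m * ∑ f ∈ Mon Fq m, (chi c f : ℝ) * (psi (lam f G) : ℝ)

/-- The diagonal part. -/
def diagS (𝒢 : ℕ → Finset (Polynomial Fq)) (n M : ℕ) : ℝ :=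
  ∑ p ∈ Finset.HasAntidiagonal.antidiagonal n, ∑ m ∈ Finset.range (M + 1), yy Fq ^ m *
    ∑ f ∈ (Mon Fq m).filter (fun f => sqB f = 0), Tsum p.1 f * ((𝒢 p.2).card : ℝ)

lemma totalS_eq (𝒢 : ℕ → Finset (Polynomial Fq)) (n M : ℕ) :
    totalS 𝒢 n M = ∑ p ∈ Finset.HasAntidiagonal.antidiagonal n, ∑ m ∈ Finset.range (M + 1), yy Fq ^ m *
      ∑ f ∈ Mon Fq m, Tsum p.1 f * ∑ G ∈ 𝒢 p.2, (psi (lam f G) : ℝ) := by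
  unfold totalS
  refine Finset.sum_congr rfl fun p _ => ?_
  have : ∀ c ∈ Cset Fq p.1, (∑ G ∈ 𝒢 p.2, ∑ m ∈ Finset.range (M + 1), yy Fq ^ m *
      ∑ f ∈ Mon Fq m, (chi c f : ℝ) * (psi (lam f G) : ℝ)) = ∑ m ∈ Finset.range (M + 1),
      ∑ G ∈ 𝒢 p.2, yy Fq ^ m * ∑ f ∈ Mon Fq m, (chi c f : ℝ) * (psi (lam f G) : ℝ) :=
    fun c _ => Finset.sum_comm
  rw [Finset.sum_congr rfl this, Finset.sum_comm]
  refine Finset.sum_congr rfl fun m _ => ?_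
  simp only [← Finset.mul_sum]
  congr 1
  have h2 : ∀ c ∈ Cset Fq p.1, ∑ G ∈ 𝒢 p.2, ∑ f ∈ Mon Fq m, (chi c f : ℝ) * (psi (lam f G) : ℝ)
      = ∑ f ∈ Mon Fq m, (chi c f : ℝ) * ∑ G ∈ 𝒢 p.2, (psi (lam f G) : ℝ) := by
    intro c _
    rw [Finset.sum_comm]
    exact Finset.sum_congr rfl fun f _ => (Finset.mul_sum _ _ _).symm
  rw [Finset.sum_congr rfl h2, Finset.sum_comm]
  refine Finset.sum_congr rfl fun f _ => ?_
  rw [← Finset.sum_mul]; rfl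

lemma psi_abs (x : Fq) : |(psi x : ℝ)| = 1 := by
  rcases psi_eq x with h | h <;> rw [h] <;> norm_num

lemma geomQ {Q : ℝ} (hQ : 2 ≤ Q) (n : ℕ) : ∑ i ∈ Finset.range n, Q ^ i ≤ Q ^ n := by
  induction n with
  | zero => simp
  | succ n ih =>
    rw [Finset.sum_range_succ, pow_succ]
    have : 0 ≤ Q ^ n := by positivity
    nlinarith

lemma geomQ2 {Q : ℝ} (hQ : 2 ≤ Q) (n : ℕ) : ∑ m ∈ Finset.range (2 * n), Q ^ (m / 2) ≤ 2 * Q ^ n := by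
  have : ∑ m ∈ Finset.range (2 * n), Q ^ (m / 2) = 2 * ∑ i ∈ Finset.range n, Q ^ i := by
    induction n with
    | zero => simp
    | succ n ih =>
      rw [show 2 * (n + 1) = 2 * n + 1 + 1 by ring, Finset.sum_range_succ, Finset.sum_range_succ, ih,
        Finset.sum_range_succ]
      have h1 : 2 * n / 2 = n := by omega
      have h2 : (2 * n + 1) / 2 = n := by omega
      rw [h1, h2]; ring
  rw [this]
  linarith [geomQ hQ n]

lemma sq_le_two_pow (n : ℕ) : ((n : ℝ) + 1) ^ 2 ≤ 8 * 2 ^ n := by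
  have : (n : ℝ) ^ 2 + 4 * n + 6 ≤ 8 * 2 ^ n := by
    induction n with
    | zero => norm_num
    | succ n ih =>
      push_cast
      rw [pow_succ (2 : ℝ) n]
      have : (0 : ℝ) ≤ n := Nat.cast_nonneg n
      nlinarith
  have : (0 : ℝ) ≤ n := Nat.cast_nonneg n
  nlinarith

lemma off_bound {𝒢 : ℕ → Finset (Polynomial Fq)} (h𝒢 : GFam 𝒢) (hξ : ∃ t : Fq, psi t = -1)
    (n M : ℕ) (hM : M + 1 ≤ 2 * n) :
    |totalS 𝒢 n M - diagS 𝒢 n M| ≤ (64 * (Fintype.card Fq : ℝ) ^ 2 + 256 * (Fintype.card Fq : ℝ)) *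
      (Fintype.card Fq : ℝ) ^ (2 * n) := by
  set Q : ℝ := (Fintype.card Fq : ℝ) with hQ
  have hq : 0 < Q := card_pos'
  have hq2 : 2 ≤ Q := two_le_card
  have h1 : totalS 𝒢 n M - diagS 𝒢 n M =
      ∑ p ∈ Finset.HasAntidiagonal.antidiagonal n, ∑ m ∈ Finset.range (M + 1), yy Fq ^ m *
      ∑ f ∈ (Mon Fq m).filter (fun f => sqB f ≠ 0), Tsum p.1 f * ∑ G ∈ 𝒢 p.2, (psi (lam f G) : ℝ) := by
    rw [totalS_eq, diagS, ← Finset.sum_sub_distrib]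
    refine Finset.sum_congr rfl fun p _ => ?_
    rw [← Finset.sum_sub_distrib]
    refine Finset.sum_congr rfl fun m _ => ?_
    rw [← mul_sub]
    congr 1
    rw [← Finset.sum_filter_add_sum_filter_not (Mon Fq m) (fun f => sqB f = 0)]
    have : ∑ f ∈ (Mon Fq m).filter (fun f => sqB f = 0), Tsum p.1 f *
        ∑ G ∈ 𝒢 p.2, (psi (lam f G) : ℝ) =
        ∑ f ∈ (Mon Fq m).filter (fun f => sqB f = 0), Tsum p.1 f * ((𝒢 p.2).card : ℝ) := by
      refine Finset.sum_congr rfl fun f hf => ?_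
      rw [Finset.mem_filter] at hf
      simp [lam_of_sqB hf.2, psi_zero]
    rw [this]; ring
  have h2 : ∀ p : ℕ × ℕ, ∀ m, |yy Fq ^ m *
      ∑ f ∈ (Mon Fq m).filter (fun f => sqB f ≠ 0), Tsum p.1 f * ∑ G ∈ 𝒢 p.2, (psi (lam f G) : ℝ)| ≤
      16 * Q ^ 2 * Q ^ p.1 * Q ^ (m / 2) + 8 * Q * (p.1 + 1) * Q ^ p.1 := by
    intro p m
    have e1 : ∑ f ∈ (Mon Fq m).filter (fun f => sqB f ≠ 0), Tsum p.1 f *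
        ∑ G ∈ 𝒢 p.2, (psi (lam f G) : ℝ) =
        ∑ f ∈ (Mon Fq m).filter (fun f => sqB f ≠ 0 ∧ (sqB f).natDegree + p.2 ≤ m / 2), Tsum p.1 f *
        ∑ G ∈ 𝒢 p.2, (psi (lam f G) : ℝ) := by
      rw [← Finset.filter_filter]
      symm
      refine Finset.sum_subset (Finset.filter_subset _ _) ?_
      intro f hf hn
      rw [Finset.mem_filter] at hf hn
      have hm := mem_Mon.1 hf.1
      rw [h𝒢.orth p.2 f hm.1 hf.2, mul_zero]
      intro hle
      rw [hm.2] at hle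
      exact hn ⟨Finset.mem_filter.2 hf, hle⟩
    rw [e1, abs_mul, abs_of_pos (pow_pos yy_pos m)]
    have e2 : |∑ f ∈ (Mon Fq m).filter (fun f => sqB f ≠ 0 ∧ (sqB f).natDegree + p.2 ≤ m / 2),
        Tsum p.1 f * ∑ G ∈ 𝒢 p.2, (psi (lam f G) : ℝ)| ≤
        (2 * (Q ^ (m / 2 + 1) / Q ^ p.2 * Q ^ p.1 * (4 * Q ^ (m / 2 + 1) + 2 * (p.1 + 1)))) *
          (2 * Q ^ p.2) := by
      refine (Finset.abs_sum_le_sum_abs _ _).trans ?_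
      refine le_trans (Finset.sum_le_sum (g := fun f => |Tsum p.1 f| * (2 * Q ^ p.2)) fun f _ => ?_) ?_
      · rw [abs_mul]
        refine mul_le_mul_of_nonneg_left ?_ (abs_nonneg _)
        refine (Finset.abs_sum_le_sum_abs _ _).trans ?_
        simp only [psi_abs, Finset.sum_const, nsmul_eq_mul, mul_one]
        exact h𝒢.card_le p.2
      · rw [← Finset.sum_mul]
        exact mul_le_mul_of_nonneg_right (sum_Tsum_le hξ m p.2 p.1) (by positivity)
    calc _ ≤ (Q ^ (m / 2))⁻¹ * ((2 * (Q ^ (m / 2 + 1) / Q ^ p.2 * Q ^ p.1 *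
            (4 * Q ^ (m / 2 + 1) + 2 * (p.1 + 1)))) * (2 * Q ^ p.2)) := by
          gcongr
          exact yy_pow_le m
      _ = _ := by
          rw [pow_succ]
          field_simp
          ring
  rw [h1]
  calc _ ≤ ∑ p ∈ Finset.HasAntidiagonal.antidiagonal n, ∑ m ∈ Finset.range (2 * n),
        (16 * Q ^ 2 * Q ^ p.1 * Q ^ (m / 2) + 8 * Q * (p.1 + 1) * Q ^ p.1) := by
        refine (Finset.abs_sum_le_sum_abs _ _).trans (Finset.sum_le_sum fun p _ => ?_)
        refine (Finset.abs_sum_le_sum_abs _ _).trans ?_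
        refine (Finset.sum_le_sum fun m _ => h2 p m).trans ?_
        apply Finset.sum_le_sum_of_subset_of_nonneg
        · intro m hm; rw [Finset.mem_range] at *; omega
        · intro m _ _; positivity
    _ ≤ ∑ p ∈ Finset.HasAntidiagonal.antidiagonal n, (16 * Q ^ 2 * Q ^ p.1 * (2 * Q ^ n) +
          2 * n * (8 * Q * (n + 1) * Q ^ p.1)) := by
        refine Finset.sum_le_sum fun p hp => ?_
        rw [Finset.sum_add_distrib, ← Finset.mul_sum, Finset.sum_const, Finset.card_range,
          nsmul_eq_mul]
        have hp1 : p.1 ≤ n := by have := Finset.HasAntidiagonal.mem_antidiagonal.1 hp; omega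
        have hp2 : (p.1 : ℝ) ≤ n := by exact_mod_cast hp1
        push_cast
        gcongr
        exact geomQ2 hq2 n
    _ = (32 * Q ^ 2 * Q ^ n + 16 * Q * (n * (n + 1))) * ∑ r ∈ Finset.range (n + 1), Q ^ r := by
        rw [Finset.Nat.sum_antidiagonal_eq_sum_range_succ_mk, Finset.mul_sum]
        refine Finset.sum_congr rfl fun r _ => ?_
        ring
    _ ≤ (32 * Q ^ 2 * Q ^ n + 16 * Q * (8 * Q ^ n)) * (2 * Q ^ n) := by
        have h5 : (n : ℝ) * (n + 1) ≤ 8 * Q ^ n := by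
          have h3 := sq_le_two_pow n
          have h4 : (2 : ℝ) ^ n ≤ Q ^ n := by gcongr
          have : (0 : ℝ) ≤ n := Nat.cast_nonneg n
          nlinarith
        have h6 : ∑ r ∈ Finset.range (n + 1), Q ^ r ≤ 2 * Q ^ n := by
          rw [Finset.sum_range_succ]
          linarith [geomQ hq2 n]
        refine mul_le_mul ?_ h6 (by positivity) (by positivity)
        linarith [mul_le_mul_of_nonneg_left h5 (show 0 ≤ 16 * Q by positivity)]
    _ = _ := by rw [two_mul n, pow_add]; ring

end Family
end EvenChar

namespace EvenChar
open scoped Classical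
open Filter Topology
set_option linter.unusedSectionVars false

section Euler
variable {Fq : Type} [Field Fq] [Fintype Fq] [CharP Fq 2]

lemma sum_divs_mul {P N : Polynomial Fq} (hP : P.Monic) (hPi : Irreducible P) (hN : N.Monic)
    (g : Polynomial Fq → ℝ) :
    ∑ D ∈ divs (P * N), g D = ∑ D ∈ divs N, g (P * D) +
      ∑ D ∈ (divs N).filter (fun D => ¬ P ∣ D), g D := by
  have hPN := hP.mul hN
  rw [← Finset.sum_filter_add_sum_filter_not (divs (P * N)) (fun D => P ∣ D)]
  congr 1
  · have : (divs (P * N)).filter (fun D => P ∣ D) = (divs N).image (P * ·) := by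
      ext D
      rw [Finset.mem_filter, Finset.mem_image, mem_divs hPN]
      constructor
      · rintro ⟨⟨h1, h2⟩, E, rfl⟩
        exact ⟨E, (mem_divs hN).2 ⟨hP.of_mul_monic_left h1,
          (mul_dvd_mul_iff_left hP.ne_zero).1 h2⟩, rfl⟩
      · rintro ⟨E, hE, rfl⟩
        rw [mem_divs hN] at hE
        exact ⟨⟨hP.mul hE.1, mul_dvd_mul_left _ hE.2⟩, dvd_mul_right _ _⟩
    rw [this, Finset.sum_image]
    intro a _ b _ h
    exact mul_left_cancel₀ hP.ne_zero h
  · congr 1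
    ext D
    rw [Finset.mem_filter, Finset.mem_filter, mem_divs hPN, mem_divs hN]
    constructor
    · rintro ⟨⟨h1, h2⟩, h3⟩
      refine ⟨⟨h1, ?_⟩, h3⟩
      exact IsCoprime.dvd_of_dvd_mul_left ((Irreducible.coprime_iff_not_dvd hPi).2 h3).symm h2
    · rintro ⟨⟨h1, h2⟩, h3⟩
      exact ⟨⟨h1, h2.mul_left _⟩, h3⟩

lemma eq_of_sum_divs (a b : Polynomial Fq → ℝ)
    (h : ∀ N : Polynomial Fq, N.Monic → ∑ D ∈ divs N, a D = ∑ D ∈ divs N, b D) (n : ℕ) :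
    ∀ N : Polynomial Fq, N.Monic → N.natDegree = n → a N = b N := by
  induction n using Nat.strong_induction_on with
  | _ n ih =>
  intro N hN hn
  have h1 := h N hN
  have hmem : N ∈ divs N := (mem_divs hN).2 ⟨hN, dvd_rfl⟩
  rw [← Finset.add_sum_erase _ _ hmem, ← Finset.add_sum_erase _ _ hmem] at h1
  have h2 : ∑ D ∈ (divs N).erase N, a D = ∑ D ∈ (divs N).erase N, b D := by
    refine Finset.sum_congr rfl fun D hD => ?_
    rw [Finset.mem_erase, mem_divs hN] at hD
    refine ih D.natDegree ?_ D hD.2.1 rfl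
    rw [← hn]
    refine lt_of_le_of_ne (natDegree_le_of_dvd hD.2.2 hN.ne_zero) fun he => hD.1 ?_
    obtain ⟨E, hE⟩ := hD.2.2
    have hEm : E.Monic := hD.2.1.of_mul_monic_left (hE ▸ hN)
    rw [hE, hD.2.1.natDegree_mul hEm] at he
    have : E = 1 := hEm.natDegree_eq_zero.1 (by omega)
    rw [hE, this, mul_one]
  linarith

lemma phi_mul {P N : Polynomial Fq} (hP : P.Monic) (hPi : Irreducible P) (hN : N.Monic) :
    (phi (P * N) : ℝ) = ((Fintype.card Fq : ℝ) ^ P.natDegree - 1) * phi N +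
      if P ∣ N then (phi N : ℝ) else 0 := by
  refine eq_of_sum_divs (fun N => (phi (P * N) : ℝ)) (fun N =>
    ((Fintype.card Fq : ℝ) ^ P.natDegree - 1) * phi N + if P ∣ N then (phi N : ℝ) else 0) ?_
    N.natDegree N hN rfl
  intro N hN
  have h1 := sum_divs_mul hP hPi hN (fun D => (phi D : ℝ))
  rw [sum_phi_divs (hP.mul hN), hP.natDegree_mul hN, pow_add] at h1
  have h2 := sum_phi_divs hN
  have h3 := Finset.sum_filter_add_sum_filter_not (divs N) (fun D => P ∣ D) (fun D => (phi D : ℝ))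
  rw [Finset.sum_add_distrib, ← Finset.mul_sum, ← Finset.sum_filter]
  rw [h2] at h3 ⊢
  linarith

/-- Number of data of conductor degree `r` and conductor divisible by `d`. -/
def Vd (d : Polynomial Fq) (r : ℕ) : ℝ := ∑ N ∈ (Mon Fq r).filter (d ∣ ·), (phi N : ℝ)

lemma Vd_nonneg (d : Polynomial Fq) (r : ℕ) : 0 ≤ Vd d r :=
  Finset.sum_nonneg fun _ _ => Nat.cast_nonneg _

lemma Vd_eq (d : Polynomial Fq) (r : ℕ) :
    Vd d r = ∑ c ∈ Cset Fq r, if d ∣ cond c then (1 : ℝ) else 0 := by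
  rw [sum_Cset_cond r (fun N => if d ∣ N then (1 : ℝ) else 0), Vd, Finset.sum_filter]
  refine Finset.sum_congr rfl fun N _ => ?_
  split_ifs <;> simp

lemma Vd_one (r : ℕ) : Vd (1 : Polynomial Fq) r = ((Cset Fq r).card : ℝ) := by
  rw [Vd_eq]; simp

lemma Vd_lt {d : Polynomial Fq} {r : ℕ} (h : r < d.natDegree) : Vd d r = 0 := by
  rw [Vd, Mon_filter_dvd_empty h]; simp

lemma Vd_rec {P d : Polynomial Fq} (hP : P.Monic) (hPi : Irreducible P) (hPd : ¬ P ∣ d) (r : ℕ) :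
    Vd (P * d) (P.natDegree + r) = ((Fintype.card Fq : ℝ) ^ P.natDegree - 1) * Vd d r
      + Vd (P * d) r := by
  have h1 : (Mon Fq (P.natDegree + r)).filter (P * d ∣ ·) =
      ((Mon Fq r).filter (d ∣ ·)).image (P * ·) := by
    ext N
    rw [Finset.mem_filter, Finset.mem_image]
    constructor
    · rintro ⟨h1, h2⟩
      have h3 := Mon_filter_dvd (mem_Mon.2 ⟨hP, rfl⟩) r
      have h4 : N ∈ (Mon Fq (P.natDegree + r)).filter (P ∣ ·) :=
        Finset.mem_filter.2 ⟨h1, (dvd_mul_right _ _).trans h2⟩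
      rw [h3, Finset.mem_image] at h4
      obtain ⟨M, hM, rfl⟩ := h4
      exact ⟨M, Finset.mem_filter.2 ⟨hM, (mul_dvd_mul_iff_left hP.ne_zero).1 h2⟩, rfl⟩
    · rintro ⟨M, hM, rfl⟩
      rw [Finset.mem_filter, mem_Mon] at hM
      exact ⟨mem_Mon.2 ⟨hP.mul hM.1.1, by rw [hP.natDegree_mul hM.1.1, hM.1.2]⟩,
        mul_dvd_mul_left _ hM.2⟩
  rw [Vd, h1, Finset.sum_image (fun a _ b _ h => mul_left_cancel₀ hP.ne_zero h)]
  have h2 : ∀ N ∈ (Mon Fq r).filter (d ∣ ·), (phi (P * N) : ℝ) =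
      ((Fintype.card Fq : ℝ) ^ P.natDegree - 1) * phi N + if P ∣ N then (phi N : ℝ) else 0 := by
    intro N hN
    rw [Finset.mem_filter, mem_Mon] at hN
    exact phi_mul hP hPi hN.1.1
  rw [Finset.sum_congr rfl h2, Finset.sum_add_distrib, ← Finset.mul_sum, ← Finset.sum_filter,
    Finset.filter_filter]
  congr 1
  rw [Vd]
  congr 1
  ext N
  rw [Finset.mem_filter, Finset.mem_filter]
  refine and_congr_right fun _ => ⟨fun h => ?_, fun h => ?_⟩
  · exact ((Irreducible.coprime_iff_not_dvd hPi).2 hPd).mul_dvd h.2 h.1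
  · exact ⟨(dvd_mul_left _ _).trans h, (dvd_mul_right _ _).trans h⟩

lemma Vd_mul_le {P d : Polynomial Fq} (r : ℕ) : Vd (P * d) r ≤ Vd d r := by
  apply Finset.sum_le_sum_of_subset_of_nonneg
  · intro N hN
    rw [Finset.mem_filter] at *
    exact ⟨hN.1, (dvd_mul_left _ _).trans hN.2⟩
  · intro _ _ _; exact Nat.cast_nonneg _

/-- linear recursion lemma -/
lemma tendsto_of_rec {x α : ℕ → ℝ} {a c B : ℝ} {p : ℕ} (hc0 : 0 ≤ c) (hc1 : c < 1)
    (hrec : ∀ r, x (p + r) = α r + c * x r) (hα : Tendsto α atTop (𝓝 a))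
    (hB : ∀ r, |x r| ≤ B) : Tendsto x atTop (𝓝 (a / (1 - c))) := by
  set L := a / (1 - c) with hL
  have hL' : L = a + c * L := by
    rw [hL]; field_simp [show (1 - c) ≠ 0 by linarith]; ring
  set B' := B + |L| with hB'
  have hB'' : ∀ r, |x r - L| ≤ B' := fun r => (abs_sub _ _).trans (by linarith [hB r])
  have hB0 : 0 ≤ B' := (abs_nonneg _).trans (hB'' 0)
  have key : ∀ ε > 0, ∀ k : ℕ, ∀ᶠ r in atTop, |x r - L| ≤ c ^ k * B' + ε := by
    intro ε hε k
    induction k with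
    | zero => exact Eventually.of_forall fun r => by simpa using (hB'' r).trans (by linarith)
    | succ k ih =>
      have h1 : ∀ᶠ r in atTop, |α r - a| < (1 - c) * ε := by
        have := Metric.tendsto_nhds.1 hα ((1 - c) * ε) (mul_pos (by linarith) hε)
        simpa [Real.dist_eq] using this
      have h2 : ∀ᶠ r in atTop, |x (p + r) - L| ≤ c ^ (k + 1) * B' + ε := by
        filter_upwards [ih, h1] with r h3 h4
        have e : x (p + r) - L = (α r - a) + c * (x r - L) := by
          rw [hrec]; linear_combination -hL'
        rw [e]
        refine (abs_add_le _ _).trans ?_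
        rw [abs_mul, abs_of_nonneg hc0, pow_succ]
        have := mul_le_mul_of_nonneg_left h3 hc0
        nlinarith
      obtain ⟨R, hR⟩ := eventually_atTop.1 h2
      refine eventually_atTop.2 ⟨p + R, fun r hr => ?_⟩
      have := hR (r - p) (by omega)
      rwa [show p + (r - p) = r by omega] at this
  rw [Metric.tendsto_nhds]
  intro ε hε
  have h1 : Tendsto (fun k : ℕ => c ^ k * B') atTop (𝓝 0) := by
    simpa using (tendsto_pow_atTop_nhds_zero_of_lt_one hc0 hc1).mul_const B'
  obtain ⟨k, hk⟩ := (h1.eventually (gt_mem_nhds (show (0 : ℝ) < ε / 2 by linarith))).exists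
  filter_upwards [key (ε / 4) (by linarith) k] with r hr
  rw [Real.dist_eq]
  linarith

variable (Fq) in
/-- The set of primes. -/
abbrev Pr : Type := {P : Polynomial Fq // P.Monic ∧ Irreducible P}

/-- Product of a finite set of primes. -/
def dS (S : Finset (Pr Fq)) : Polynomial Fq := ∏ P ∈ S, P.1

/-- Norm of a prime. -/
def nm (P : Pr Fq) : ℝ := (Fintype.card Fq : ℝ) ^ P.1.natDegree

lemma nm_ge (P : Pr Fq) : 2 ≤ nm P := by
  have h := P.2.2.natDegree_pos
  calc (2 : ℝ) ≤ (Fintype.card Fq : ℝ) := two_le_card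
    _ = (Fintype.card Fq : ℝ) ^ 1 := (pow_one _).symm
    _ ≤ _ := pow_le_pow_right₀ (by linarith [two_le_card (Fq := Fq)]) h

lemma dS_monic (S : Finset (Pr Fq)) : (dS S).Monic := monic_prod_of_monic _ _ fun P _ => P.2.1

lemma dS_insert {S : Finset (Pr Fq)} {P : Pr Fq} (h : P ∉ S) : dS (insert P S) = P.1 * dS S := by
  rw [dS, Finset.prod_insert h]; rfl

lemma prime_dvd_dS {S : Finset (Pr Fq)} {P : Pr Fq} : P.1 ∣ dS S ↔ P ∈ S := by
  constructor
  · intro h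
    obtain ⟨R, hR, hd⟩ := (P.2.2.prime.dvd_finsetProd_iff _).1 h
    have := eq_of_monic_of_associated P.2.1 R.2.1 (P.2.2.associated_of_dvd R.2.2 hd)
    rwa [Subtype.ext this]
  · intro h; exact Finset.dvd_prod_of_mem (fun P : Pr Fq => P.1) h

lemma dS_dvd_iff {S : Finset (Pr Fq)} (N : Polynomial Fq) : dS S ∣ N ↔ ∀ P ∈ S, P.1 ∣ N := by
  constructor
  · intro h P hP; exact (prime_dvd_dS.2 hP).trans h
  · intro h
    apply Finset.prod_dvd_of_coprime
    · intro P _ R _ hne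
      exact coprime_of_ne P.2.1 R.2.1 P.2.2 R.2.2 (fun he => hne (Subtype.ext he))
    · exact h

lemma nm_dS (S : Finset (Pr Fq)) : (Fintype.card Fq : ℝ) ^ (dS S).natDegree = ∏ P ∈ S, nm P := by
  rw [dS, natDegree_prod_of_monic _ _ (fun P _ => P.2.1), Finset.prod_pow_eq_pow_sum .. |>.symm]
  rfl

lemma card_Cset_le (r : ℕ) : ((Cset Fq r).card : ℝ) ≤ (Fintype.card Fq : ℝ) ^ (2 * r) := by
  cases r with
  | zero => rw [card_Cset_zero]; simp
  | succ r =>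
    rw [card_Cset_succ]
    apply mul_le_of_le_one_right (by positivity)
    have : (0 : ℝ) < (Fintype.card Fq : ℝ)⁻¹ := inv_pos.2 card_pos'
    linarith

lemma Vd_bound (S : Finset (Pr Fq)) : ∀ r, Vd (dS S) r ≤
    (Fintype.card Fq : ℝ) ^ (2 * r) * ∏ P ∈ S, (nm P)⁻¹ := by
  have hq : (0 : ℝ) < Fintype.card Fq := card_pos'
  induction S using Finset.induction_on with
  | empty => intro r; simpa [dS, Vd_one] using card_Cset_le r
  | insert P S hP ih =>
    intro r
    have hnm := nm_ge P
    have hpr : 0 ≤ ∏ P ∈ S, (nm P)⁻¹ :=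
      Finset.prod_nonneg fun R _ => inv_nonneg.2 (by linarith [nm_ge R])
    rw [dS_insert hP, Finset.prod_insert hP]
    by_cases h : P.1.natDegree ≤ r
    · obtain ⟨k, rfl⟩ := Nat.exists_eq_add_of_le h
      rw [Vd_rec P.2.1 P.2.2 (fun hd => hP (prime_dvd_dS.1 hd))]
      have h1 := Vd_mul_le (P := P.1) (d := dS S) k
      calc _ ≤ nm P * Vd (dS S) k := by unfold nm; linarith
        _ ≤ nm P * ((Fintype.card Fq : ℝ) ^ (2 * k) * ∏ P ∈ S, (nm P)⁻¹) := by
            gcongr; exact ih k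
        _ = _ := by
          rw [mul_add, pow_add, mul_comm 2 P.1.natDegree, pow_mul _ P.1.natDegree 2]
          change _ = nm P ^ 2 * _ * _
          field_simp
    · rw [Vd_lt]
      · have := inv_nonneg.2 (show 0 ≤ nm P by linarith)
        positivity
      · rw [P.2.1.natDegree_mul (dS_monic S)]; omega

lemma Vd_tendsto (S : Finset (Pr Fq)) :
    Tendsto (fun r => Vd (dS S) r / (Fintype.card Fq : ℝ) ^ (2 * r)) atTop
      (𝓝 ((1 - (Fintype.card Fq : ℝ)⁻¹) * ∏ P ∈ S, (nm P + 1)⁻¹)) := by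
  have hq : (0 : ℝ) < Fintype.card Fq := card_pos'
  induction S using Finset.induction_on with
  | empty =>
    apply tendsto_const_nhds.congr'
    filter_upwards [eventually_ge_atTop 1] with r hr
    obtain ⟨k, rfl⟩ := Nat.exists_eq_add_of_le' hr
    simp only [dS, Finset.prod_empty, Vd_one, card_Cset_succ]
    field_simp
  | insert P S hP ih =>
    have hnm := nm_ge P
    have h1 : ∀ r, Vd (dS (insert P S)) (P.1.natDegree + r) /
        (Fintype.card Fq : ℝ) ^ (2 * (P.1.natDegree + r)) =
        ((nm P - 1) / nm P ^ 2) * (Vd (dS S) r / (Fintype.card Fq : ℝ) ^ (2 * r)) +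
        (1 / nm P ^ 2) * (Vd (dS (insert P S)) r / (Fintype.card Fq : ℝ) ^ (2 * r)) := by
      intro r
      rw [dS_insert hP, Vd_rec P.2.1 P.2.2 (fun hd => hP (prime_dvd_dS.1 hd)), mul_add, pow_add,
        mul_comm 2 P.1.natDegree, pow_mul]
      change ((nm P - 1) * _ + _) / (nm P ^ 2 * _) = _
      field_simp
    have h2 := tendsto_of_rec (B := 1) (x := fun r => Vd (dS (insert P S)) r /
      (Fintype.card Fq : ℝ) ^ (2 * r)) (by positivity) (by
        rw [div_lt_one (by positivity)]; nlinarith) h1 (ih.const_mul _) (by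
        intro r
        rw [abs_of_nonneg (div_nonneg (Vd_nonneg _ _) (by positivity)),
          div_le_one (by positivity)]
        refine (Vd_bound _ _).trans (mul_le_of_le_one_right (by positivity) ?_)
        apply Finset.prod_le_one
        · intro R _; exact inv_nonneg.2 (by linarith [nm_ge R])
        · intro R _; exact inv_le_one_of_one_le₀ (by linarith [nm_ge R]))
    convert h2 using 2
    rw [Finset.prod_insert hP]
    have : nm P ^ 2 - 1 ≠ 0 := by nlinarith
    have h3 : nm P + 1 ≠ 0 := by linarith
    have h4 : nm P ≠ 0 := by linarith
    have h5 : nm P - 1 ≠ 0 := by intro h; linarith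
    have h6 : 1 - 1 / nm P ^ 2 = (nm P - 1) * (nm P + 1) / nm P ^ 2 := by field_simp; ring
    rw [h6]
    field_simp

end Euler
end EvenChar

namespace EvenChar
open scoped Classical
open Filter Topology
set_option linter.unusedSectionVars false

section Diag
variable {Fq : Type} [Field Fq] [Fintype Fq] [CharP Fq 2]

variable (Fq) in
/-- Primes of degree less than `n`. -/
def PrLT (n : ℕ) : Finset (Pr Fq) :=
  ((Finset.range n).biUnion (Mon Fq)).subtype (fun P => P.Monic ∧ Irreducible P)

lemma mem_PrLT {n : ℕ} {P : Pr Fq} : P ∈ PrLT Fq n ↔ P.1.natDegree < n := by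
  simp only [PrLT, Finset.mem_subtype, Finset.mem_biUnion, Finset.mem_range, mem_Mon]
  constructor
  · rintro ⟨a, h1, h2, h3⟩; omega
  · intro h; exact ⟨_, h, P.2.1, rfl⟩

lemma not_isCoprime_iff {h N : Polynomial Fq} (hh : h ≠ 0) :
    ¬ IsCoprime h N ↔ ∃ P : Pr Fq, P.1 ∣ h ∧ P.1 ∣ N := by
  constructor
  · intro hc
    by_contra hn
    push Not at hn
    apply hc
    refine isCoprime_of_prime_dvd (fun h0 => hh h0.1) fun z hz h1 h2 => ?_
    have hz0 : z ≠ 0 := hz.ne_zero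
    have hm : (normalize z).Monic := monic_normalize hz0
    have hi : Irreducible (normalize z) := (normalize_associated z).symm.irreducible hz.irreducible
    exact hn ⟨normalize z, hm, hi⟩ (normalize_dvd_iff.2 h1) (normalize_dvd_iff.2 h2)
  · rintro ⟨P, h1, h2⟩ hc
    exact P.2.2.not_isUnit (hc.isUnit_of_dvd' h1 h2)

lemma coprime_ind {n : ℕ} {h N : Polynomial Fq} (hh : h ≠ 0) (hn : h.natDegree < n) :
    (if IsCoprime h N then 1 else 0 : ℝ) = ∑ S ∈ (PrLT Fq n).powerset,
      (-1) ^ S.card * ((if dS S ∣ h then 1 else 0) * (if dS S ∣ N then 1 else 0)) := by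
  have h1 : ∀ S : Finset (Pr Fq), (-1 : ℝ) ^ S.card * ((if dS S ∣ h then 1 else 0) *
      (if dS S ∣ N then 1 else 0)) = if (dS S ∣ h ∧ dS S ∣ N) then (-1 : ℝ) ^ S.card else 0 := by
    intro S
    by_cases a : dS S ∣ h <;> by_cases b : dS S ∣ N <;> simp [a, b]
  simp_rw [h1]
  rw [← Finset.sum_filter]
  have h2 : (PrLT Fq n).powerset.filter (fun S => dS S ∣ h ∧ dS S ∣ N) =
      ((PrLT Fq n).filter (fun P => P.1 ∣ h ∧ P.1 ∣ N)).powerset := by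
    ext S
    simp only [Finset.mem_filter, Finset.mem_powerset, dS_dvd_iff, Finset.subset_iff]
    constructor
    · rintro ⟨a, b, c⟩ P hP; exact ⟨a hP, b P hP, c P hP⟩
    · intro a; exact ⟨fun P hP => (a hP).1, fun P hP => (a hP).2.1, fun P hP => (a hP).2.2⟩
  rw [h2]
  have h3 := Finset.sum_powerset_neg_one_pow_card
    (x := (PrLT Fq n).filter (fun P => P.1 ∣ h ∧ P.1 ∣ N))
  have h4 := congrArg (fun z : ℤ => (z : ℝ)) h3
  push_cast at h4
  rw [h4]
  congr 1
  rw [eq_iff_iff, ← not_iff_not, not_isCoprime_iff hh, ← ne_eq, ← Finset.nonempty_iff_ne_empty]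
  constructor
  · rintro ⟨P, a, b⟩
    exact ⟨P, Finset.mem_filter.2 ⟨mem_PrLT.2 ((natDegree_le_of_dvd a hh).trans_lt hn), a, b⟩⟩
  · rintro ⟨P, hP⟩
    exact ⟨P, (Finset.mem_filter.1 hP).2⟩

lemma Tsum_sq (hξ : ∃ t : Fq, psi t = -1) {n : ℕ} {h : Polynomial Fq} (hh : h.Monic)
    (hn : h.natDegree < n) (r : ℕ) :
    Tsum r (h ^ 2) = ∑ S ∈ (PrLT Fq n).powerset,
      (-1) ^ S.card * ((if dS S ∣ h then 1 else 0) * Vd (dS S) r) := by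
  have h1 : Tsum r (h ^ 2) = ∑ c ∈ Cset Fq r, ∑ S ∈ (PrLT Fq n).powerset,
      (-1) ^ S.card * ((if dS S ∣ h then 1 else 0) * (if dS S ∣ cond c then 1 else 0 : ℝ)) := by
    unfold Tsum
    refine Finset.sum_congr rfl fun c hc => ?_
    rw [chi_sq (hh.pow 2) hξ (mem_Cset.1 hc).1 ((sqB_eq_zero_iff _).2 ⟨h, rfl⟩),
      ← coprime_ind hh.ne_zero hn]
    simp only [IsCoprime.pow_left_iff (show 0 < 2 by norm_num)]
    split_ifs <;> simp
  rw [h1, Finset.sum_comm]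
  refine Finset.sum_congr rfl fun S _ => ?_
  rw [Vd_eq, ← Finset.mul_sum, ← Finset.mul_sum]

lemma sq_inj {a b : Polynomial Fq} (h : a ^ 2 = b ^ 2) : a = b := by
  have : (a - b) ^ 2 = 0 := by rw [sub_pow_char]; rw [h, sub_self]
  exact sub_eq_zero.1 (pow_eq_zero_iff (two_ne_zero) |>.1 this)

lemma Mon_sq_even (l : ℕ) :
    (Mon Fq (2 * l)).filter (fun f => sqB f = 0) = (Mon Fq l).image (fun h => h ^ 2) := by
  ext f
  simp only [Finset.mem_filter, Finset.mem_image, mem_Mon, sqB_eq_zero_iff]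
  constructor
  · rintro ⟨⟨h1, h2⟩, h, rfl⟩
    have hd : h.natDegree = l := by rw [natDegree_pow] at h2; omega
    refine ⟨h, ⟨?_, hd⟩, rfl⟩
    have h3 : h.leadingCoeff ^ 2 = 1 := by rw [← leadingCoeff_pow]; exact h1
    have h4 : (h.leadingCoeff - 1) ^ 2 = 0 := by rw [sub_pow_char, h3]; simp
    exact sub_eq_zero.1 (pow_eq_zero_iff (two_ne_zero) |>.1 h4)
  · rintro ⟨h, ⟨h1, h2⟩, rfl⟩
    exact ⟨⟨h1.pow 2, by rw [natDegree_pow, h2]⟩, h, rfl⟩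

lemma Mon_sq_odd (l : ℕ) : (Mon Fq (2 * l + 1)).filter (fun f => sqB f = 0) = ∅ := by
  rw [Finset.filter_eq_empty_iff]
  intro f hf h0
  rw [mem_Mon] at hf
  obtain ⟨h, rfl⟩ := (sqB_eq_zero_iff _).1 h0
  have := hf.2
  rw [natDegree_pow] at this; omega

lemma sum_range_two_mul (a : ℕ → ℝ) (n : ℕ) :
    ∑ m ∈ Finset.range (2 * n), a m = ∑ l ∈ Finset.range n, (a (2 * l) + a (2 * l + 1)) := by
  induction n with
  | zero => simp
  | succ k ih => rw [mul_add, mul_one, Finset.sum_range_succ, Finset.sum_range_succ, ih,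
      Finset.sum_range_succ]; ring

lemma sum_sq (g : Polynomial Fq → ℝ) {n M : ℕ} (hM : M + 1 = 2 * n ∨ M + 2 = 2 * n) :
    ∑ m ∈ Finset.range (M + 1), yy Fq ^ m * ∑ f ∈ (Mon Fq m).filter (fun f => sqB f = 0), g f =
    ∑ l ∈ Finset.range n, ((Fintype.card Fq : ℝ) ^ l)⁻¹ * ∑ h ∈ Mon Fq l, g (h ^ 2) := by
  have h1 : ∑ m ∈ Finset.range (M + 1), yy Fq ^ m *
      ∑ f ∈ (Mon Fq m).filter (fun f => sqB f = 0), g f = ∑ m ∈ Finset.range (2 * n), yy Fq ^ m *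
      ∑ f ∈ (Mon Fq m).filter (fun f => sqB f = 0), g f := by
    rcases hM with hM | hM
    · rw [hM]
    · obtain ⟨k, rfl⟩ : ∃ k, n = k + 1 := ⟨n - 1, by omega⟩
      rw [show 2 * (k + 1) = (M + 1) + 1 by omega, Finset.sum_range_succ _ (M + 1),
        show M + 1 = 2 * k + 1 by omega, Mon_sq_odd]
      simp
  rw [h1, sum_range_two_mul]
  refine Finset.sum_congr rfl fun l _ => ?_
  rw [Mon_sq_odd, Mon_sq_even, Finset.sum_image (fun a _ b _ h => sq_inj h), yy_pow_even]
  simp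

lemma sum_dvd {d : Polynomial Fq} (hd : d.Monic) (n : ℕ) :
    ∑ l ∈ Finset.range n, ((Fintype.card Fq : ℝ) ^ l)⁻¹ * ∑ h ∈ Mon Fq l,
      (if d ∣ h then 1 else 0 : ℝ) =
    ((n - d.natDegree : ℕ) : ℝ) * ((Fintype.card Fq : ℝ) ^ d.natDegree)⁻¹ := by
  have hq : (0 : ℝ) < Fintype.card Fq := card_pos'
  have h1 : ∀ l ∈ Finset.range n, ((Fintype.card Fq : ℝ) ^ l)⁻¹ * ∑ h ∈ Mon Fq l,
      (if d ∣ h then 1 else 0 : ℝ) =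
      if d.natDegree ≤ l then ((Fintype.card Fq : ℝ) ^ d.natDegree)⁻¹ else 0 := by
    intro l _
    rw [Finset.sum_boole]
    split_ifs with h
    · rw [card_Mon_filter_dvd (mem_Mon.2 ⟨hd, rfl⟩) h]
      obtain ⟨k, rfl⟩ := Nat.exists_eq_add_of_le h
      rw [Nat.add_sub_cancel_left, pow_add]; push_cast
      field_simp
    · rw [Mon_filter_dvd_empty (by omega)]; simp
  rw [Finset.sum_congr rfl h1, ← Finset.sum_filter, Finset.sum_const, nsmul_eq_mul]
  congr 2
  have : (Finset.range n).filter (fun l => d.natDegree ≤ l) = Finset.Ico d.natDegree n := by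
    ext x; simp [and_comm]
  rw [this, Nat.card_Ico]

/-- Weighted count of the family with conductor divisible by `d`. -/
def kap (𝒢 : ℕ → Finset (Polynomial Fq)) (d : Polynomial Fq) (n : ℕ) : ℝ :=
  ∑ p ∈ Finset.HasAntidiagonal.antidiagonal n, ((𝒢 p.2).card : ℝ) * Vd d p.1

/-- Main summand. -/
def trm (𝒢 : ℕ → Finset (Polynomial Fq)) (n : ℕ) (S : Finset (Pr Fq)) : ℝ :=
  (-1) ^ S.card * (((n - (dS S).natDegree : ℕ) : ℝ) * (∏ P ∈ S, nm P)⁻¹ * kap 𝒢 (dS S) n)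

lemma diagS_eq (hξ : ∃ t : Fq, psi t = -1) (𝒢 : ℕ → Finset (Polynomial Fq)) {n M : ℕ}
    (hM : M + 1 = 2 * n ∨ M + 2 = 2 * n) :
    diagS 𝒢 n M = ∑' S : Finset (Pr Fq), trm 𝒢 n S := by
  rw [tsum_eq_sum (s := (PrLT Fq n).powerset)]
  · unfold diagS
    have h1 : ∀ p ∈ Finset.HasAntidiagonal.antidiagonal n, ∑ m ∈ Finset.range (M + 1), yy Fq ^ m *
        ∑ f ∈ (Mon Fq m).filter (fun f => sqB f = 0), Tsum p.1 f * ((𝒢 p.2).card : ℝ) =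
        ∑ S ∈ (PrLT Fq n).powerset, (-1) ^ S.card *
          (((n - (dS S).natDegree : ℕ) : ℝ) * (∏ P ∈ S, nm P)⁻¹ *
            (((𝒢 p.2).card : ℝ) * Vd (dS S) p.1)) := by
      intro p _
      rw [sum_sq _ hM]
      have h2 : ∀ l ∈ Finset.range n, ((Fintype.card Fq : ℝ) ^ l)⁻¹ *
          ∑ h ∈ Mon Fq l, Tsum p.1 (h ^ 2) * ((𝒢 p.2).card : ℝ) =
          ∑ S ∈ (PrLT Fq n).powerset, (-1) ^ S.card * (((𝒢 p.2).card : ℝ) * Vd (dS S) p.1) *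
            (((Fintype.card Fq : ℝ) ^ l)⁻¹ * ∑ h ∈ Mon Fq l, (if dS S ∣ h then 1 else 0 : ℝ)) := by
        intro l hl
        have h3 : ∀ h ∈ Mon Fq l, Tsum p.1 (h ^ 2) * ((𝒢 p.2).card : ℝ) =
            ∑ S ∈ (PrLT Fq n).powerset, (-1) ^ S.card * ((𝒢 p.2).card * Vd (dS S) p.1) *
              (if dS S ∣ h then 1 else 0 : ℝ) := by
          intro h hh
          rw [mem_Mon] at hh
          rw [Tsum_sq hξ (n := n) hh.1 (by rw [hh.2]; exact Finset.mem_range.1 hl),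
            Finset.sum_mul]
          refine Finset.sum_congr rfl fun S _ => ?_
          ring
        rw [Finset.sum_congr rfl h3, Finset.sum_comm, Finset.mul_sum]
        refine Finset.sum_congr rfl fun S _ => ?_
        rw [← Finset.mul_sum]; ring
      rw [Finset.sum_congr rfl h2, Finset.sum_comm]
      refine Finset.sum_congr rfl fun S _ => ?_
      rw [← Finset.mul_sum, sum_dvd (dS_monic S), nm_dS]
      ring
    rw [Finset.sum_congr rfl h1, Finset.sum_comm]
    refine Finset.sum_congr rfl fun S _ => ?_
    rw [trm, kap, Finset.mul_sum, Finset.mul_sum]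
  · intro S hS
    rw [Finset.mem_powerset, Finset.subset_iff] at hS
    push Not at hS
    obtain ⟨P, hP, hP'⟩ := hS
    rw [mem_PrLT] at hP'
    have h1 : P.1.natDegree ≤ (dS S).natDegree :=
      natDegree_le_of_dvd (prime_dvd_dS.2 hP) (dS_monic S).ne_zero
    have : n - (dS S).natDegree = 0 := by omega
    simp [trm, this]

/-- Mass of the polynomial parts. -/
def Gam (𝒢 : ℕ → Finset (Polynomial Fq)) : ℝ :=
  ∑' s, ((𝒢 s).card : ℝ) / (Fintype.card Fq : ℝ) ^ (2 * s)

lemma Gam_summable {𝒢 : ℕ → Finset (Polynomial Fq)} (h : GFam 𝒢) :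
    Summable (fun s => ((𝒢 s).card : ℝ) / (Fintype.card Fq : ℝ) ^ (2 * s)) := by
  have hq : (0 : ℝ) < Fintype.card Fq := card_pos'
  have hq2 : (2 : ℝ) ≤ Fintype.card Fq := by exact_mod_cast two_le_card
  refine Summable.of_nonneg_of_le (fun s => by positivity) (fun s => ?_)
    ((summable_geometric_of_lt_one (r := (Fintype.card Fq : ℝ)⁻¹) (by positivity)
      (inv_lt_one_of_one_lt₀ (by linarith))).mul_left 2)
  rw [div_le_iff₀ (by positivity)]
  refine (h.card_le s).trans (le_of_eq ?_)
  rw [two_mul s, pow_add, inv_pow]; field_simp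

lemma Gam_pos {𝒢 : ℕ → Finset (Polynomial Fq)} (h : GFam 𝒢) : 0 < Gam 𝒢 := by
  have hq : (0 : ℝ) < Fintype.card Fq := card_pos'
  obtain ⟨s, hs⟩ := h.nonempty
  refine (Gam_summable h).tsum_pos (fun s => by positivity) s ?_
  have : 0 < (𝒢 s).card := hs.card_pos
  positivity

lemma kap_div (𝒢 : ℕ → Finset (Polynomial Fq)) (d : Polynomial Fq) (n : ℕ) :
    kap 𝒢 d n / (Fintype.card Fq : ℝ) ^ (2 * n) =
    ∑' s, if s ≤ n then ((𝒢 s).card : ℝ) / (Fintype.card Fq : ℝ) ^ (2 * s) *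
      (Vd d (n - s) / (Fintype.card Fq : ℝ) ^ (2 * (n - s))) else 0 := by
  have hq : (0 : ℝ) < Fintype.card Fq := card_pos'
  rw [tsum_eq_sum (s := Finset.range (n + 1))]
  · rw [kap, ← Finset.Nat.sum_antidiagonal_swap, Finset.Nat.sum_antidiagonal_eq_sum_range_succ_mk, Finset.sum_div]
    refine Finset.sum_congr rfl fun s hs => ?_
    have hs' : s ≤ n := by simpa [Nat.lt_succ_iff] using hs
    rw [if_pos hs', div_mul_div_comm, ← pow_add]
    simp only [Prod.swap]
    congr 2; omega
  · intro s hs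
    rw [if_neg]; simpa using hs

lemma kap_term_bound {𝒢 : ℕ → Finset (Polynomial Fq)} (S : Finset (Pr Fq)) (n s : ℕ) :
    ‖(if s ≤ n then ((𝒢 s).card : ℝ) / (Fintype.card Fq : ℝ) ^ (2 * s) *
      (Vd (dS S) (n - s) / (Fintype.card Fq : ℝ) ^ (2 * (n - s))) else 0)‖ ≤
    ((𝒢 s).card : ℝ) / (Fintype.card Fq : ℝ) ^ (2 * s) * ∏ P ∈ S, (nm P)⁻¹ := by
  have hq : (0 : ℝ) < Fintype.card Fq := card_pos'
  have hpr : 0 ≤ ∏ P ∈ S, (nm P)⁻¹ :=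
    Finset.prod_nonneg fun R _ => inv_nonneg.2 (by linarith [nm_ge R])
  split_ifs with h
  · have hV := Vd_nonneg (dS S) (n - s)
    rw [Real.norm_of_nonneg (by positivity)]
    gcongr
    rw [div_le_iff₀ (by positivity), mul_comm]
    exact Vd_bound S _
  · rw [norm_zero]; positivity

lemma kap_nonneg (𝒢 : ℕ → Finset (Polynomial Fq)) (d : Polynomial Fq) (n : ℕ) : 0 ≤ kap 𝒢 d n :=
  Finset.sum_nonneg fun _ _ => mul_nonneg (Nat.cast_nonneg _) (Vd_nonneg _ _)

lemma kap_bound {𝒢 : ℕ → Finset (Polynomial Fq)} (h : GFam 𝒢) (S : Finset (Pr Fq)) (n : ℕ) :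
    kap 𝒢 (dS S) n / (Fintype.card Fq : ℝ) ^ (2 * n) ≤ Gam 𝒢 * ∏ P ∈ S, (nm P)⁻¹ := by
  rw [kap_div, Gam, ← tsum_mul_right]
  have hs := (Gam_summable h).mul_right (∏ P ∈ S, (nm P)⁻¹)
  refine Summable.tsum_le_tsum (fun s => (le_abs_self _).trans (kap_term_bound S n s))
    (Summable.of_norm_bounded hs (kap_term_bound S n)) hs

lemma kap_tendsto {𝒢 : ℕ → Finset (Polynomial Fq)} (h : GFam 𝒢) (S : Finset (Pr Fq)) :
    Tendsto (fun n => kap 𝒢 (dS S) n / (Fintype.card Fq : ℝ) ^ (2 * n)) atTop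
      (𝓝 (Gam 𝒢 * ((1 - (Fintype.card Fq : ℝ)⁻¹) * ∏ P ∈ S, (nm P + 1)⁻¹))) := by
  simp_rw [kap_div]
  rw [Gam, ← tsum_mul_right]
  refine tendsto_tsum_of_dominated_convergence
    ((Gam_summable h).mul_right (∏ P ∈ S, (nm P)⁻¹)) (fun s => ?_)
    (Eventually.of_forall fun n s => kap_term_bound S n s)
  have h1 := ((Vd_tendsto S).comp (tendsto_sub_atTop_nat s)).const_mul
    (((𝒢 s).card : ℝ) / (Fintype.card Fq : ℝ) ^ (2 * s))
  refine h1.congr' ?_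
  filter_upwards [eventually_ge_atTop s] with n hn
  rw [if_pos hn]; rfl

lemma nm_summable : Summable (fun P : Pr Fq => (nm P)⁻¹ ^ 2) := by
  have hq : (0 : ℝ) < Fintype.card Fq := card_pos'
  have hq2 : (2 : ℝ) ≤ Fintype.card Fq := by exact_mod_cast two_le_card
  have hr : (Fintype.card Fq : ℝ)⁻¹ < 1 := inv_lt_one_of_one_lt₀ (by linarith)
  have hsum := summable_geometric_of_lt_one (r := (Fintype.card Fq : ℝ)⁻¹) (by positivity) hr
  refine summable_of_sum_le (c := ∑' m, (Fintype.card Fq : ℝ)⁻¹ ^ m) (fun P => by positivity) ?_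
  intro u
  set n := u.sup (fun P => P.1.natDegree) + 1 with hn
  have h1 : ∑ P ∈ u, (nm P)⁻¹ ^ 2 = ∑ f ∈ u.image Subtype.val,
      ((Fintype.card Fq : ℝ) ^ f.natDegree)⁻¹ ^ 2 := by
    rw [Finset.sum_image (fun a _ b _ h => Subtype.ext h)]; rfl
  rw [h1]
  have h2 : u.image Subtype.val ⊆ (Finset.range n).biUnion (Mon Fq) := by
    intro f hf
    obtain ⟨P, hP, rfl⟩ := Finset.mem_image.1 hf
    have : P.1.natDegree ≤ u.sup (fun P => P.1.natDegree) :=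
      Finset.le_sup (f := fun P : Pr Fq => P.1.natDegree) hP
    exact Finset.mem_biUnion.2 ⟨_, Finset.mem_range.2 (by omega), mem_Mon.2 ⟨P.2.1, rfl⟩⟩
  refine (Finset.sum_le_sum_of_subset_of_nonneg h2 fun _ _ _ => by positivity).trans ?_
  rw [Finset.sum_biUnion]
  · refine le_trans (le_of_eq ?_) (hsum.sum_le_tsum (Finset.range n) fun _ _ => by positivity)
    refine Finset.sum_congr rfl fun m _ => ?_
    rw [Finset.sum_congr rfl (fun f hf => by rw [(mem_Mon.1 hf).2]), Finset.sum_const, card_Mon,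
      nsmul_eq_mul]
    push_cast
    simp only [inv_pow]; field_simp
  · intro a _ b _ hab
    rw [Function.onFun, Finset.disjoint_left]
    intro f h3 h4
    exact hab ((mem_Mon.1 h3).2.symm.trans (mem_Mon.1 h4).2)

variable (Fq) in
/-- The Euler product, expanded. -/
def EE : ℝ := ∑' S : Finset (Pr Fq), ∏ P ∈ S, (-(nm P * (nm P + 1))⁻¹)

lemma diag_tendsto {𝒢 : ℕ → Finset (Polynomial Fq)} (h : GFam 𝒢) :
    Tendsto (fun n : ℕ => (∑' S : Finset (Pr Fq), trm 𝒢 n S) / (n * (Fintype.card Fq : ℝ) ^ (2 * n)))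
      atTop (𝓝 (Gam 𝒢 * (1 - (Fintype.card Fq : ℝ)⁻¹) * EE Fq)) := by
  have hq : (0 : ℝ) < Fintype.card Fq := card_pos'
  rw [EE, ← tsum_mul_left]
  simp_rw [← tsum_div_const]
  have hb : Summable (fun S : Finset (Pr Fq) => Gam 𝒢 * ∏ P ∈ S, (nm P)⁻¹ ^ 2) :=
    (summable_finsetProd_of_summable_nonneg (fun P => by positivity) nm_summable).mul_left _
  refine tendsto_tsum_of_dominated_convergence hb (fun S => ?_) ?_
  · have h1 : Tendsto (fun n : ℕ => ((n - (dS S).natDegree : ℕ) : ℝ) / n) atTop (𝓝 1) := by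
      have h2 : Tendsto (fun n : ℕ => 1 - ((dS S).natDegree : ℝ) / n) atTop (𝓝 (1 - 0)) :=
        tendsto_const_nhds.sub (tendsto_const_div_atTop_nhds_zero_nat _)
      rw [sub_zero] at h2
      refine h2.congr' ?_
      filter_upwards [eventually_ge_atTop (dS S).natDegree, eventually_gt_atTop 0] with n hn h0
      rw [Nat.cast_sub hn]
      have : (n : ℝ) ≠ 0 := by positivity
      field_simp
    have h2 := ((h1.mul (kap_tendsto h S)).const_mul (∏ P ∈ S, nm P)⁻¹).const_mul
      ((-1 : ℝ) ^ S.card)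
    refine (h2.congr fun n => ?_).trans (le_of_eq ?_)
    · rw [trm]; field_simp
    · congr 1
      rw [Finset.prod_neg, Finset.prod_inv_distrib, Finset.prod_inv_distrib, Finset.prod_mul_distrib,
        mul_inv]
      ring
  · filter_upwards [eventually_gt_atTop 0] with n h0 S
    have h0' : (0 : ℝ) < n := by exact_mod_cast h0
    have hp : 0 < ∏ P ∈ S, nm P := Finset.prod_pos fun P _ => by linarith [nm_ge P]
    have hk := kap_nonneg 𝒢 (dS S) n
    rw [trm, norm_div, norm_mul, norm_pow, norm_neg, norm_one, one_pow, one_mul,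
      Real.norm_of_nonneg (by positivity), Real.norm_of_nonneg (by positivity)]
    have h3 : ((n - (dS S).natDegree : ℕ) : ℝ) / n ≤ 1 := by
      rw [div_le_one h0']; exact_mod_cast Nat.sub_le _ _
    calc _ = (((n - (dS S).natDegree : ℕ) : ℝ) / n) * ((∏ P ∈ S, nm P)⁻¹ *
          (kap 𝒢 (dS S) n / (Fintype.card Fq : ℝ) ^ (2 * n))) := by field_simp
      _ ≤ 1 * ((∏ P ∈ S, nm P)⁻¹ * (Gam 𝒢 * ∏ P ∈ S, (nm P)⁻¹)) := by
          gcongr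
          exact kap_bound h S n
      _ = _ := by
          rw [Finset.prod_pow, Finset.prod_inv_distrib]; ring

lemma total_tendsto {𝒢 : ℕ → Finset (Polynomial Fq)} (h : GFam 𝒢) (hξ : ∃ t : Fq, psi t = -1)
    (M : ℕ → ℕ) (hM : ∀ n, 1 ≤ n → (M n + 1 = 2 * n ∨ M n + 2 = 2 * n)) :
    Tendsto (fun n : ℕ => totalS 𝒢 n (M n) / kap 𝒢 1 n / n) atTop (𝓝 (EE Fq)) := by
  have hq : (0 : ℝ) < Fintype.card Fq := card_pos'
  have hq2 : (2 : ℝ) ≤ Fintype.card Fq := by exact_mod_cast two_le_card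
  have hr : (Fintype.card Fq : ℝ)⁻¹ < 1 := inv_lt_one_of_one_lt₀ (by linarith)
  have hG := Gam_pos h
  have h1 := diag_tendsto h
  have h2 := kap_tendsto h (∅ : Finset (Pr Fq))
  simp only [dS, Finset.prod_empty, mul_one] at h2
  have hne : Gam 𝒢 * (1 - (Fintype.card Fq : ℝ)⁻¹) ≠ 0 :=
    mul_ne_zero hG.ne' (by linarith)
  set K := (64 * (Fintype.card Fq : ℝ) ^ 2 + 256 * (Fintype.card Fq : ℝ)) with hK
  have h3 : Tendsto (fun n : ℕ => (totalS 𝒢 n (M n) - diagS 𝒢 n (M n)) /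
      (n * (Fintype.card Fq : ℝ) ^ (2 * n))) atTop (𝓝 0) := by
    refine squeeze_zero_norm' ?_ (tendsto_const_div_atTop_nhds_zero_nat K)
    filter_upwards [eventually_ge_atTop 1] with n hn
    have hn' : (0 : ℝ) < n := by exact_mod_cast hn
    have hb := off_bound h hξ n (M n) (by rcases hM n hn with h | h <;> omega)
    rw [norm_div, Real.norm_eq_abs, Real.norm_of_nonneg (by positivity), div_le_div_iff₀ (by positivity) hn']
    calc _ ≤ (K * (Fintype.card Fq : ℝ) ^ (2 * n)) * n := by gcongr
      _ = _ := by ring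
  have h4 := (h1.add h3).div h2 hne
  rw [add_zero, mul_div_cancel_left₀ _ hne] at h4
  refine h4.congr' ?_
  filter_upwards [eventually_ge_atTop 1] with n hn
  have hn' : (0 : ℝ) < n := by exact_mod_cast hn
  simp only [Pi.div_apply]
  rw [← diagS_eq hξ 𝒢 (hM n hn), ← add_div, add_sub_cancel]
  field_simp

end Diag
end EvenChar

namespace EvenChar
open scoped Classical
open Filter Topology
set_option linter.unusedSectionVars false

section Final
variable {Fq : Type} [Field Fq] [Fintype Fq] [CharP Fq 2]

lemma U_eq_sum {c : Coef Fq} {S : Finset (Polynomial Fq)} {e : Polynomial Fq → ℕ}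
    (h : c.support ⊆ S.sigma (fun P => Finset.range (e P))) :
    U c = ∑ P ∈ S, ∑ i ∈ Finset.Icc 1 (e P),
      algebraMap (Polynomial Fq) (RatFunc Fq) (c ⟨P, i - 1⟩) /
        algebraMap (Polynomial Fq) (RatFunc Fq) P ^ (2 * i - 1) := by
  unfold U
  rw [Finsupp.sum_of_support_subset _ h _ (fun j _ => by simp), Finset.sum_sigma]
  refine Finset.sum_congr rfl fun P _ => ?_
  refine Finset.sum_nbij' (· + 1) (· - 1) ?_ ?_ ?_ ?_ ?_
  · intro i hi
    rw [Finset.mem_range] at hi; rw [Finset.mem_Icc]; omega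
  · intro i hi
    rw [Finset.mem_Icc] at hi; rw [Finset.mem_range]; omega
  · intro i _; simp
  · intro i hi
    rw [Finset.mem_Icc] at hi; omega
  · intro i _
    rw [Nat.add_sub_cancel]
    rfl

lemma natDegree_cond {c : Coef Fq} (hc : isX c) :
    (cond c).natDegree = ∑ P ∈ c.support.image Sigma.fst, expo c P * P.natDegree := by
  rw [cond, natDegree_prod_of_monic _ _ (fun P hP => (hc.prime hP).1.pow _)]
  refine Finset.sum_congr rfl fun P _ => ?_
  rw [natDegree_pow]

lemma Ffam_eq (n : ℕ) : Ffam Fq n = U '' (Cset Fq n : Set (Coef Fq)) := by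
  ext u
  constructor
  · rintro ⟨S, e, a, h1, h2, h3, h4, h5, rfl⟩
    set J := S.sigma (fun P => Finset.range (e P)) with hJ
    have hmem : ∀ (P : Polynomial Fq) (i : ℕ), (⟨P, i⟩ : Σ _ : Polynomial Fq, ℕ) ∈ J ↔
        P ∈ S ∧ i < e P := by
      intro P i
      rw [hJ, Finset.mem_sigma, Finset.mem_range]
    set c : Coef Fq := Finsupp.onFinset J (fun j => if j ∈ J then a j.1 (j.2 + 1) else 0)
      (fun j hj => by by_contra h; exact hj (if_neg h)) with hcdef
    have hval : ∀ P ∈ S, ∀ i < e P, c ⟨P, i⟩ = a P (i + 1) := by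
      intro P hP i hi
      rw [hcdef, Finsupp.onFinset_apply, if_pos ((hmem P i).2 ⟨hP, hi⟩)]
    have hsup : c.support ⊆ J := Finsupp.support_onFinset_subset
    have hc : isX c := by
      rintro ⟨P, i⟩ hj
      have hj' := (hmem P i).1 (hsup hj)
      refine ⟨(h1 P hj'.1).1, (h1 P hj'.1).2, ?_⟩
      rw [hval P hj'.1 i hj'.2]
      exact h3 P hj'.1 (i + 1) (by omega) (by omega)
    have htop : ∀ P ∈ S, (⟨P, e P - 1⟩ : Σ _ : Polynomial Fq, ℕ) ∈ c.support := by
      intro P hP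
      have := h2 P hP
      rw [Finsupp.mem_support_iff, hval P hP _ (by omega), Nat.sub_add_cancel this]
      exact h4 P hP
    have himg : c.support.image Sigma.fst = S := by
      ext P
      rw [Finset.mem_image]
      constructor
      · rintro ⟨⟨P', i⟩, hj, rfl⟩
        exact ((hmem _ _).1 (hsup hj)).1
      · intro hP; exact ⟨_, htop P hP, rfl⟩
    have hexpo : ∀ P ∈ S, expo c P = e P := by
      intro P hP
      have := h2 P hP
      obtain ⟨i, hi, hi2⟩ := expo_spec (c := c) (P := P) (by rw [himg]; exact hP)
      have h6 := ((hmem _ _).1 (hsup hi)).2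
      have h7 := le_expo (htop P hP)
      simp only at h7
      omega
    refine ⟨c, ?_, ?_⟩
    · rw [Finset.mem_coe, mem_Cset]
      refine ⟨hc, ?_⟩
      rw [natDegree_cond hc, himg, ← h5]
      exact Finset.sum_congr rfl fun P hP => by rw [hexpo P hP]
    · rw [U_eq_sum hsup]
      refine Finset.sum_congr rfl fun P hP => Finset.sum_congr rfl fun i hi => ?_
      rw [Finset.mem_Icc] at hi
      rw [hval P hP _ (by omega), Nat.sub_add_cancel hi.1]
  · rintro ⟨c, hc, rfl⟩
    rw [Finset.mem_coe, mem_Cset] at hc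
    obtain ⟨hc, hd⟩ := hc
    refine ⟨c.support.image Sigma.fst, expo c, fun P i => c ⟨P, i - 1⟩, fun P hP => hc.prime hP,
      ?_, ?_, ?_, ?_, ?_⟩
    · intro P hP
      obtain ⟨i, hi, hi2⟩ := expo_spec hP
      omega
    · intro P hP i _ _
      by_cases h0 : c ⟨P, i - 1⟩ = 0
      · beta_reduce
        rw [h0, degree_zero, bot_lt_iff_ne_bot, ne_eq, degree_eq_bot]
        exact (hc.prime hP).1.ne_zero
      · exact (hc ⟨P, i - 1⟩ (Finsupp.mem_support_iff.2 h0)).2.2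
    · intro P hP
      obtain ⟨i, hi, hi2⟩ := expo_spec hP
      rw [hi2]
      beta_reduce
      rw [Nat.add_sub_cancel]
      exact Finsupp.mem_support_iff.1 hi
    · rw [← natDegree_cond hc, hd]
    · apply U_eq_sum
      rintro ⟨P, i⟩ hj
      rw [Finset.mem_sigma, Finset.mem_range]
      exact ⟨Finset.mem_image_of_mem _ hj, le_expo hj⟩

/-- Index set for a family. -/
def pairs (𝒢 : ℕ → Finset (Polynomial Fq)) (n : ℕ) : Finset (Coef Fq × Polynomial Fq) :=
  (Finset.HasAntidiagonal.antidiagonal n).biUnion (fun p => Cset Fq p.1 ×ˢ 𝒢 p.2)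

lemma mem_pairs {𝒢 : ℕ → Finset (Polynomial Fq)} {n : ℕ} {x : Coef Fq × Polynomial Fq} :
    x ∈ pairs 𝒢 n ↔ ∃ r s, r + s = n ∧ x.1 ∈ Cset Fq r ∧ x.2 ∈ 𝒢 s := by
  simp only [pairs, Finset.mem_biUnion, Finset.mem_product, Finset.HasAntidiagonal.mem_antidiagonal, Prod.exists]

lemma sum_pairs {E : Type*} [AddCommMonoid E] (𝒢 : ℕ → Finset (Polynomial Fq)) (n : ℕ)
    (g : Coef Fq × Polynomial Fq → E) :
    ∑ x ∈ pairs 𝒢 n, g x = ∑ p ∈ Finset.HasAntidiagonal.antidiagonal n,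
      ∑ c ∈ Cset Fq p.1, ∑ G ∈ 𝒢 p.2, g (c, G) := by
  rw [pairs, Finset.sum_biUnion]
  · exact Finset.sum_congr rfl fun p _ => Finset.sum_product _ _ _
  · intro p hp p' hp' hne
    rw [Function.onFun, Finset.disjoint_left]
    intro x h1 h2
    rw [Finset.mem_product, mem_Cset] at h1 h2
    rw [Finset.mem_coe, Finset.HasAntidiagonal.mem_antidiagonal] at hp hp'
    have : p.1 = p'.1 := h1.1.2.symm.trans h2.1.2
    exact hne (Prod.ext this (by omega))

/-- The rational function attached to a pair. -/
def toU (x : Coef Fq × Polynomial Fq) : RatFunc Fq :=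
  U x.1 + algebraMap (Polynomial Fq) (RatFunc Fq) x.2

lemma toU_inj (𝒢 : ℕ → Finset (Polynomial Fq)) (n : ℕ) :
    Set.InjOn toU (pairs 𝒢 n : Set (Coef Fq × Polynomial Fq)) := by
  intro x hx y hy h
  obtain ⟨_, _, _, hx, _⟩ := mem_pairs.1 (Finset.mem_coe.1 hx)
  obtain ⟨_, _, _, hy, _⟩ := mem_pairs.1 (Finset.mem_coe.1 hy)
  have := U_injective (mem_Cset.1 hx).1 (mem_Cset.1 hy).1 h
  exact Prod.ext this.1 this.2

lemma Ffam_pairs (n : ℕ) : Ffam Fq n = ((pairs (G0 (0 : Polynomial Fq)) n).image toU : Finset _) := by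
  rw [Ffam_eq]
  ext u
  simp only [Set.mem_image, Finset.coe_image, Finset.mem_coe, mem_pairs]
  constructor
  · rintro ⟨c, hc, rfl⟩
    exact ⟨(c, 0), ⟨n, 0, by simp, hc, by simp [G0]⟩, by simp [toU]⟩
  · rintro ⟨⟨c, G⟩, ⟨r, s, hrs, hc, hG⟩, rfl⟩
    unfold G0 at hG
    split_ifs at hG with h
    · subst h
      simp only [Finset.mem_singleton] at hG
      subst hG
      refine ⟨c, ?_, by simp [toU]⟩
      rw [← hrs]; exact hc
    · simp at hG

lemma F'fam_pairs (ξ : Fq) (n : ℕ) :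
    F'fam ξ n = ((pairs (G0 (C ξ : Polynomial Fq)) n).image toU : Finset _) := by
  rw [F'fam, Ffam_eq]
  ext u
  simp only [Set.mem_image, Finset.coe_image, Finset.mem_coe, mem_pairs]
  constructor
  · rintro ⟨_, ⟨c, hc, rfl⟩, rfl⟩
    exact ⟨(c, C ξ), ⟨n, 0, by simp, hc, by simp [G0]⟩, by simp [toU]⟩
  · rintro ⟨⟨c, G⟩, ⟨r, s, hrs, hc, hG⟩, rfl⟩
    unfold G0 at hG
    split_ifs at hG with h
    · subst h
      simp only [Finset.mem_singleton] at hG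
      subst hG
      refine ⟨_, ⟨c, ?_, rfl⟩, by simp [toU]⟩
      rw [← hrs]; exact hc
    · simp at hG

lemma Ifam_pairs (ξ : Fq) (n : ℕ) :
    Ifam ξ n = ((pairs (GI ξ) n).image toU : Finset _) := by
  ext u
  simp only [Ifam, Irs, Ffam_eq, Set.mem_iUnion, Set.mem_setOf_eq, Set.mem_image, Finset.coe_image,
    Finset.mem_coe, mem_pairs]
  constructor
  · rintro ⟨r, s, hs, hrs, _, ⟨c, hc, rfl⟩, G, hG, rfl⟩
    refine ⟨(c, G), ⟨r, s, hrs, hc, ?_⟩, rfl⟩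
    rw [GI, if_neg (by omega)]
    exact mem_Gset.2 hG
  · rintro ⟨⟨c, G⟩, ⟨r, s, hrs, hc, hG⟩, rfl⟩
    unfold GI at hG
    split_ifs at hG with h
    · simp at hG
    · exact ⟨r, s, by omega, hrs, _, ⟨c, hc, rfl⟩, G, mem_Gset.1 hG, rfl⟩

lemma Acoeff_eq (hξ : ∃ t : Fq, psi t = -1) {c : Coef Fq} (hc : isX c) (G : Polynomial Fq) (m : ℕ) :
    Acoeff (toU (c, G)) m =
      ((∑ f ∈ Mon Fq m, (chi c f : ℝ) * (psi (lam f G) : ℝ) : ℝ) : ℂ) := by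
  have h1 : Acoeff (toU (c, G)) m = ∑ f ∈ Mon Fq m, (quadSym (toU (c, G)) f : ℂ) := by
    rw [← Finset.tsum_subtype']
    unfold Acoeff
    have hset : {f : Polynomial Fq | f.Monic ∧ f.natDegree = m} = ↑(Mon Fq m) := by
      ext f; simp [mem_Mon]
    exact tsum_congr_set_coe (fun f => (quadSym (toU (c, G)) f : ℂ)) hset
  rw [h1, Complex.ofReal_sum]
  refine Finset.sum_congr rfl fun f hf => ?_
  rw [toU, quadSym_add_poly (mem_Mon.1 hf).1 hξ hc]
  push_cast; rfl

lemma yy_cpow (m : ℕ) :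
    (Fintype.card Fq : ℂ) ^ (-((1 / 2 : ℂ) * (m : ℂ))) = ((yy Fq ^ m : ℝ) : ℂ) := by
  have hq : (0 : ℝ) < Fintype.card Fq := card_pos'
  have h1 : (Fintype.card Fq : ℂ) = ((Fintype.card Fq : ℝ) : ℂ) := by simp
  have h2 : (-((1 / 2 : ℂ) * (m : ℂ))) = ((-((1 / 2 : ℝ) * m) : ℝ) : ℂ) := by push_cast; ring
  rw [h1, h2, ← Complex.ofReal_cpow hq.le]
  congr 1
  rw [Real.rpow_neg hq.le, Real.rpow_mul hq.le, ← Real.sqrt_eq_rpow, Real.rpow_natCast, yy, inv_pow]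

lemma Lfun_eq (hξ : ∃ t : Fq, psi t = -1) {c : Coef Fq} (hc : isX c) (G : Polynomial Fq) (N : ℕ) :
    Lfun N (toU (c, G)) (1 / 2) = ((∑ m ∈ Finset.range (N + 1), yy Fq ^ m *
      ∑ f ∈ Mon Fq m, (chi c f : ℝ) * (psi (lam f G) : ℝ) : ℝ) : ℂ) := by
  rw [Lfun, Complex.ofReal_sum]
  refine Finset.sum_congr rfl fun m _ => ?_
  rw [Acoeff_eq hξ hc, yy_cpow, Complex.ofReal_mul, mul_comm]

lemma family_sum (hξ : ∃ t : Fq, psi t = -1) (𝒢 : ℕ → Finset (Polynomial Fq)) (n N : ℕ)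
    {T : Set (RatFunc Fq)} (hT : T = ((pairs 𝒢 n).image toU : Finset _)) :
    (∑' u : T, Lfun N u.1 (1 / 2)) = ((totalS 𝒢 n N : ℝ) : ℂ) := by
  subst hT
  rw [Finset.tsum_subtype' ((pairs 𝒢 n).image toU) (fun u => Lfun N u (1 / 2)),
    Finset.sum_image (toU_inj 𝒢 n), sum_pairs, totalS, Complex.ofReal_sum]
  refine Finset.sum_congr rfl fun p _ => ?_
  rw [Complex.ofReal_sum]
  refine Finset.sum_congr rfl fun c hc => ?_
  rw [Complex.ofReal_sum]
  refine Finset.sum_congr rfl fun G _ => ?_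
  rw [Lfun_eq hξ (mem_Cset.1 hc).1]

lemma family_card (𝒢 : ℕ → Finset (Polynomial Fq)) (n : ℕ)
    {T : Set (RatFunc Fq)} (hT : T = ((pairs 𝒢 n).image toU : Finset _)) :
    (Nat.card T : ℂ) = ((kap 𝒢 1 n : ℝ) : ℂ) := by
  subst hT
  have h1 : Nat.card (((pairs 𝒢 n).image toU : Finset _) : Set (RatFunc Fq)) = (pairs 𝒢 n).card := by
    rw [Nat.card_coe_set_eq, Set.ncard_coe_finset, Finset.card_image_of_injOn (toU_inj 𝒢 n)]
  have h2 : ((pairs 𝒢 n).card : ℝ) = kap 𝒢 1 n := by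
    rw [← nsmul_one, ← Finset.sum_const, sum_pairs, kap]
    refine Finset.sum_congr rfl fun p _ => ?_
    simp only [Finset.sum_const, nsmul_eq_mul, mul_one, Vd_one]
    ring
  rw [h1, ← h2]; simp

lemma EE_facts : EE Fq ≠ 0 ∧ eulerP Fq 1 = ((EE Fq : ℝ) : ℂ) := by
  have hpos : ∀ P : Pr Fq, 0 < nm P := fun P => by linarith [nm_ge P]
  have hs : Summable (fun P : Pr Fq => ‖(-(nm P * (nm P + 1))⁻¹ : ℝ)‖) := by
    refine Summable.of_nonneg_of_le (fun P => norm_nonneg _) (fun P => ?_) nm_summable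
    have := hpos P
    rw [norm_neg, Real.norm_of_nonneg (by positivity), inv_pow]
    apply inv_anti₀ (by positivity)
    nlinarith
  have hE : ∏' P : Pr Fq, (1 + (-(nm P * (nm P + 1))⁻¹)) = EE Fq :=
    tprod_one_add (summable_finsetProd_of_summable_norm hs)
  constructor
  · rw [← hE]
    refine tprod_one_add_ne_zero_of_summable (fun P => ?_) hs
    have h2 := nm_ge P
    have : (nm P * (nm P + 1))⁻¹ < 1 := inv_lt_one_of_one_lt₀ (by nlinarith)
    linarith
  · have hs' : Summable (fun P : Pr Fq => ‖(-((nm P : ℂ) * (nm P + 1))⁻¹ : ℂ)‖) := by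
      refine hs.congr fun P => ?_
      rw [← Complex.norm_real]; push_cast; rfl
    have h3 : ∏' P : Pr Fq, (1 + (-((nm P : ℂ) * (nm P + 1))⁻¹)) =
        ∑' S : Finset (Pr Fq), ∏ P ∈ S, (-((nm P : ℂ) * (nm P + 1))⁻¹) :=
      tprod_one_add (summable_finsetProd_of_summable_norm hs')
    have h4 : eulerP Fq 1 = ∏' P : Pr Fq, (1 + (-((nm P : ℂ) * (nm P + 1))⁻¹)) := by
      unfold eulerP
      refine tprod_congr fun P => ?_
      rw [Complex.cpow_one, Complex.cpow_natCast, nm, sub_eq_add_neg]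
      push_cast; rfl
    rw [h4, h3, EE, Complex.ofReal_tsum]
    refine tsum_congr fun S => ?_
    push_cast; rfl

lemma family_limit {𝒢 : ℕ → Finset (Polynomial Fq)} (h : GFam 𝒢) (hξ : ∃ t : Fq, psi t = -1)
    (N : ℕ → ℕ) (hN : ∀ g, N g = 2 * g ∨ N g = 2 * g + 1) (T : ℕ → Set (RatFunc Fq))
    (hT : ∀ g, T g = ((pairs 𝒢 g).image toU : Finset _)) :
    Tendsto (fun g : ℕ => ((∑' u : T (g + 1), Lfun (N g) u.1 (1 / 2)) /
      (Nat.card (T (g + 1)) : ℂ)) / (((g : ℂ) + 1) * eulerP Fq 1)) atTop (nhds 1) := by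
  obtain ⟨hE, hE2⟩ := EE_facts (Fq := Fq)
  have h1 := total_tendsto h hξ (fun n => N (n - 1)) (fun n hn => by
    rcases hN (n - 1) with h | h <;> omega)
  have h2 := (h1.comp (tendsto_add_atTop_nat 1)).div_const (EE Fq)
  rw [div_self hE] at h2
  have h3 := (Complex.continuous_ofReal.tendsto 1).comp h2
  rw [Complex.ofReal_one] at h3
  refine h3.congr fun g => ?_
  rw [family_sum hξ 𝒢 (g + 1) (N g) (hT _), family_card 𝒢 (g + 1) (hT _), hE2]
  simp only [Function.comp, Nat.add_sub_cancel]
  push_cast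
  rw [div_div _ _ ((EE Fq : ℝ) : ℂ)]

end Final
end EvenChar

namespace EvenChar

theorem statement5 {Fq : Type} [Field Fq] [Fintype Fq] (hchar : ringChar Fq = 2)
    (hq : 2 < Fintype.card Fq) (ξ : Fq) (hξ : ∀ x : Fq, x ^ 2 + x ≠ ξ) :
    Filter.Tendsto
      (fun g : ℕ =>
        ((∑' u : (Ifam ξ (g + 1) : Set (RatFunc Fq)), Lfun (2 * g) u.1 (1 / 2)) /
            (Nat.card (Ifam ξ (g + 1) : Set (RatFunc Fq)) : ℂ)) /
          (((g : ℂ) + 1) * eulerP Fq 1))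
      Filter.atTop (nhds 1) ∧
    Filter.Tendsto
      (fun g : ℕ =>
        ((∑' u : (Ffam Fq (g + 1) : Set (RatFunc Fq)), Lfun (2 * g + 1) u.1 (1 / 2)) /
            (Nat.card (Ffam Fq (g + 1) : Set (RatFunc Fq)) : ℂ)) /
          (((g : ℂ) + 1) * eulerP Fq 1))
      Filter.atTop (nhds 1) ∧
    Filter.Tendsto
      (fun g : ℕ =>
        ((∑' u : (F'fam ξ (g + 1) : Set (RatFunc Fq)), Lfun (2 * g + 1) u.1 (1 / 2)) /
            (Nat.card (F'fam ξ (g + 1) : Set (RatFunc Fq)) : ℂ)) /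
          (((g : ℂ) + 1) * eulerP Fq 1))
      Filter.atTop (nhds 1) := by
  haveI : CharP Fq 2 := hchar ▸ ringChar.charP Fq
  have hp : psi ξ = -1 := by
    unfold psi
    rw [if_neg]
    rintro ⟨y, hy⟩
    exact hξ y hy
  exact ⟨family_limit (GFam_GI ξ hp) ⟨ξ, hp⟩ (fun g => 2 * g) (fun _ => Or.inl rfl) _
      (Ifam_pairs ξ),
    family_limit (GFam_G0 0) ⟨ξ, hp⟩ (fun g => 2 * g + 1) (fun _ => Or.inr rfl) _ Ffam_pairs,
    family_limit (GFam_G0 (C ξ)) ⟨ξ, hp⟩ (fun g => 2 * g + 1) (fun _ => Or.inr rfl) _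
      (F'fam_pairs ξ)⟩


end EvenChar
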